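/- arXiv:1705.00252 — 11 statements merged into one kernel-verified Lean document; each statement's English description precedes it below -/
import Mathlib

section
/- Let f be a log-concave probability density on ℝ, i.e. f((1−θ)x + θy) ≥ f(x)^{1−θ} f(y)^{θ} for all x, y ∈ ℝ and θ ∈ (0,1), and let F(x) = ∫_{−∞}^{x} f(y) dy be its distribution function. Then both x ↦ log F(x) and x ↦ log(1 − F(x)) are concave functions on J(F) = {x ∈ ℝ : 0 < F(x) < 1}; i.e. F and 1 − F are log-concave. -/
open MeasureTheory Set Filter

theorem setIntegral_Iic_comp_add_right (f : ℝ → ℝ) (c d : ℝ) :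
    ∫ t in Iic c, f (t + d) = ∫ t in Iic (c + d), f t := by
  have h := (measurePreserving_add_right volume d).setIntegral_preimage_emb
    (measurableEmbedding_addRight d) f (Iic (c + d))
  simpa using h

section LogConcave

variable {f : ℝ → ℝ}

theorem pos_of_mem_Icc_of_logConcave
    (hlc : ∀ x y θ : ℝ, θ ∈ Ioo (0 : ℝ) 1 →
      f x ^ (1 - θ) * f y ^ θ ≤ f ((1 - θ) * x + θ * y))
    {s t x : ℝ} (hs : 0 < f s) (ht : 0 < f t) (hx : x ∈ Icc s t) : 0 < f x := by
  rcases hx.1.eq_or_lt with rfl | hsx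
  · exact hs
  rcases hx.2.eq_or_lt with rfl | hxt
  · exact ht
  have hst : 0 < t - s := by linarith
  have h := hlc s t ((x - s) / (t - s))
    ⟨div_pos (by linarith) hst, by rw [div_lt_one hst]; linarith⟩
  rw [show (1 - (x - s) / (t - s)) * s + (x - s) / (t - s) * t = x by
    field_simp; ring] at h
  exact lt_of_lt_of_le (by positivity) h

theorem mul_le_mul_of_logConcave (hnn : ∀ x, 0 ≤ f x)
    (hlc : ∀ x y θ : ℝ, θ ∈ Ioo (0 : ℝ) 1 →
      f x ^ (1 - θ) * f y ^ θ ≤ f ((1 - θ) * x + θ * y))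
    {s x y : ℝ} (hsx : s ≤ x) (hxy : x ≤ y) : f s * f y ≤ f x * f (s + (y - x)) := by
  rcases hsx.eq_or_lt with rfl | hsx
  · simp
  rcases hxy.eq_or_lt with rfl | hxy
  · simp [mul_comm]
  have hsy : 0 < y - s := by linarith
  set θ := (x - s) / (y - s) with hθ
  have h0 : 0 < θ := div_pos (by linarith) hsy
  have h1 : θ < 1 := by rw [hθ, div_lt_one hsy]; linarith
  have hmul : θ * (y - s) = x - s := div_mul_cancel₀ _ hsy.ne'
  have hx := hlc s y θ ⟨h0, h1⟩
  have hz := hlc s y (1 - θ) ⟨by linarith, by linarith⟩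
  rw [show (1 - θ) * s + θ * y = x by linarith] at hx
  rw [show (1 - (1 - θ)) * s + (1 - θ) * y = s + (y - x) by linarith] at hz
  have hpow (a : ℝ) (ha : 0 ≤ a) : a ^ (1 - θ) * a ^ (1 - (1 - θ)) = a := by
    rw [← Real.rpow_add_of_nonneg ha (by linarith) (by linarith)]
    simp
  calc f s * f y
      = (f s ^ (1 - θ) * f y ^ θ) * (f s ^ (1 - (1 - θ)) * f y ^ (1 - θ)) := by
        conv_lhs => rw [← hpow _ (hnn s), ← hpow _ (hnn y)]
        rw [sub_sub_cancel]
        ring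
    _ ≤ f x * f (s + (y - x)) :=
        mul_le_mul hx hz
          (mul_nonneg (Real.rpow_nonneg (hnn s) _) (Real.rpow_nonneg (hnn y) _)) (hnn x)

theorem mul_setIntegral_Iic_le_of_logConcave (hnn : ∀ x, 0 ≤ f x) (hint : Integrable f)
    (hlc : ∀ x y θ : ℝ, θ ∈ Ioo (0 : ℝ) 1 →
      f x ^ (1 - θ) * f y ^ θ ≤ f ((1 - θ) * x + θ * y))
    {x y : ℝ} (hxy : x ≤ y) :
    f y * ∫ t in Iic x, f t ≤ f x * ∫ t in Iic y, f t := by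
  have hshift : ∫ t in Iic y, f t = ∫ t in Iic x, f (t + (y - x)) := by
    rw [setIntegral_Iic_comp_add_right, add_sub_cancel]
  rw [hshift, ← integral_const_mul, ← integral_const_mul]
  refine setIntegral_mono_on (hint.const_mul _).integrableOn
    ((hint.comp_add_right _).const_mul _).integrableOn measurableSet_Iic fun s hs => ?_
  rw [mul_comm (f y)]
  exact mul_le_mul_of_logConcave hnn hlc hs hxy

theorem exists_pos_of_setIntegral_pos {s : Set ℝ} (h : 0 < ∫ t in s, f t) :
    ∃ t ∈ s, f t ≠ 0 := by
  by_contra! hzero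
  exact h.ne' (setIntegral_eq_zero_of_forall_eq_zero hzero)

theorem concaveOn_log_setIntegral_Iic_of_logConcave (hnn : ∀ x, 0 ≤ f x)
    (hint : Integrable f)
    (hlc : ∀ x y θ : ℝ, θ ∈ Ioo (0 : ℝ) 1 →
      f x ^ (1 - θ) * f y ^ θ ≤ f ((1 - θ) * x + θ * y)) :
    ConcaveOn ℝ {x : ℝ | 0 < ∫ t in Iic x, f t ∧ ∫ t in Iic x, f t < ∫ t, f t}
      (fun x => Real.log (∫ t in Iic x, f t)) := by
  set F : ℝ → ℝ := fun x => ∫ t in Iic x, f t with hF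
  set J : Set ℝ := {x | 0 < F x ∧ F x < ∫ t, f t}
  have hFmono : Monotone F := fun x y hxy =>
    setIntegral_mono_set hint.integrableOn (Eventually.of_forall hnn)
      (Iic_subset_Iic.2 hxy).eventuallyLE
  have hFeq (a : ℝ) : F = fun x => F a + ∫ t in a..x, f t := by
    ext x
    rw [← intervalIntegral.integral_Iic_sub_Iic hint.integrableOn hint.integrableOn]
    ring
  have hFcont : Continuous F := by
    rw [hFeq 0]
    exact continuous_const.add (hint.continuous_primitive 0)
  have hJopen : IsOpen J :=
    (isOpen_lt continuous_const hFcont).inter (isOpen_lt hFcont continuous_const)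
  have hJconv : Convex ℝ J := by
    refine OrdConnected.convex ⟨fun x hx y hy z hz => ?_⟩
    exact ⟨hx.1.trans_le (hFmono hz.1), (hFmono hz.2).trans_lt hy.2⟩
  have hfpos : ∀ x ∈ J, 0 < f x := by
    intro x hx
    have hright : 0 < ∫ t in Ioi x, f t := by
      have := intervalIntegral.integral_Iic_add_Ioi (b := x) hint.integrableOn hint.integrableOn
      have := hx.2
      simp only [hF] at this
      linarith
    obtain ⟨s, hs, hfs⟩ := exists_pos_of_setIntegral_pos hx.1
    obtain ⟨t, ht, hft⟩ := exists_pos_of_setIntegral_pos hright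
    exact pos_of_mem_Icc_of_logConcave hlc ((hnn s).lt_of_ne' hfs) ((hnn t).lt_of_ne' hft)
      ⟨hs, le_of_lt ht⟩
  have hlog : ConcaveOn ℝ J (fun x => Real.log (f x)) := by
    refine concaveOn_iff_forall_pos.2 ⟨hJconv, fun x hx y hy a b ha hb hab => ?_⟩
    obtain rfl : a = 1 - b := by linarith
    have hfx := hfpos x hx
    have hfy := hfpos y hy
    have h := Real.log_le_log (by positivity) (hlc x y b ⟨hb, by linarith⟩)
    rwa [Real.log_mul (by positivity) (by positivity), Real.log_rpow hfx,
      Real.log_rpow hfy] at h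
  have hfcont : ContinuousOn f J :=
    (Real.continuous_exp.comp_continuousOn (hlog.continuousOn hJopen)).congr
      fun x hx => (Real.exp_log (hfpos x hx)).symm
  have hderiv : ∀ x ∈ J, HasDerivAt (fun x => Real.log (F x)) (f x / F x) x := by
    intro x hx
    have hFx : HasDerivAt F (f x) x := by
      rw [hFeq x]
      exact (intervalIntegral.integral_hasDerivAt_right hint.intervalIntegrable
        (hfcont.stronglyMeasurableAtFilter hJopen x hx)
        (hfcont.continuousAt (hJopen.mem_nhds hx))).const_add _
    exact hFx.log hx.1.ne'
  refine AntitoneOn.concaveOn_of_deriv hJconv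
    (fun x hx => (hderiv x hx).continuousAt.continuousWithinAt) ?_ ?_ <;>
    rw [hJopen.interior_eq]
  · exact fun x hx => (hderiv x hx).differentiableAt.differentiableWithinAt
  · intro x hx y hy hxy
    rw [(hderiv x hx).deriv, (hderiv y hy).deriv, div_le_div_iff₀ hy.1 hx.1]
    exact mul_setIntegral_Iic_le_of_logConcave hnn hint hlc hxy

end LogConcave



/-- If `f` is a log-concave probability density on `ℝ` with distribution
function `F x = ∫_{-∞}^x f`, then `log F` and `log (1 - F)` are concave on
`J(F) = {x | 0 < F x < 1}`; i.e. `F` and `1 - F` are log-concave. -/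
theorem logConcave_density_implies_bi_log_concave
    (f F : ℝ → ℝ)
    (hf_nonneg : ∀ x, 0 ≤ f x)
    (hf_total : ∫ x, f x = 1)
    (hf_logconcave : ∀ x y θ : ℝ, θ ∈ Set.Ioo (0 : ℝ) 1 →
      f x ^ (1 - θ) * f y ^ θ ≤ f ((1 - θ) * x + θ * y))
    (hF : ∀ x, F x = ∫ y in Set.Iic x, f y) :
    ConcaveOn ℝ {x : ℝ | 0 < F x ∧ F x < 1} (fun x => Real.log (F x)) ∧
    ConcaveOn ℝ {x : ℝ | 0 < F x ∧ F x < 1} (fun x => Real.log (1 - F x)) := by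
  have hint : Integrable f := by
    by_contra h
    simp [integral_undef h] at hf_total
  obtain rfl : F = fun x => ∫ y in Iic x, f y := funext hF
  constructor
  · simpa only [hf_total] using
      concaveOn_log_setIntegral_Iic_of_logConcave hf_nonneg hint hf_logconcave
  · have hcompl (x : ℝ) : ∫ y in Iic (-x), f (-y) = 1 - ∫ y in Iic x, f y := by
      have := intervalIntegral.integral_Iic_add_Ioi (b := x) hint.integrableOn hint.integrableOn
      rw [integral_comp_neg_Iic, neg_neg]
      linarith
    have h := (concaveOn_log_setIntegral_Iic_of_logConcave (f := fun x => f (-x))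
      (fun x => hf_nonneg (-x)) hint.comp_neg fun x y θ hθ => by
        convert hf_logconcave (-x) (-y) θ hθ using 2
        ring).comp_linearMap (-LinearMap.id)
    have hset : {x : ℝ | 0 < ∫ y in Iic x, f y ∧ ∫ y in Iic x, f y < 1} =
        (-LinearMap.id : ℝ →ₗ[ℝ] ℝ) ⁻¹' {x : ℝ | 0 < ∫ y in Iic x, f (-y) ∧
          ∫ y in Iic x, f (-y) < ∫ y, f (-y)} := by
      ext x
      simp only [mem_ofPred_eq, mem_preimage, LinearMap.neg_apply, LinearMap.id_apply, hcompl,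
        integral_neg_eq_self, hf_total]
      constructor <;> rintro ⟨h₁, h₂⟩ <;> constructor <;> linarith
    beta_reduce
    rw [hset]
    refine h.congr fun x _ => ?_
    simp only [Function.comp_apply, LinearMap.neg_apply, LinearMap.id_apply, hcompl]
end

section
/- Let s ∈ (−1, 0) and set s* = s/(1+s) ∈ (−∞, 0). Let f be an s-concave probability density on ℝ, i.e. f((1−θ)x + θy) ≥ ((1−θ) f(x)^{s} + θ f(y)^{s})^{1/s} whenever f(x) > 0, f(y) > 0 and θ ∈ (0,1), and let F(x) = ∫_{−∞}^{x} f(y) dy. Then F and 1 − F are s*-concave on J(F): for all x, y ∈ J(F) and θ ∈ (0,1), F((1−θ)x + θy)^{s*} ≤ (1−θ) F(x)^{s*} + θ F(y)^{s*} and (1 − F((1−θ)x + θy))^{s*} ≤ (1−θ)(1 − F(x))^{s*} + θ(1 − F(y))^{s*}; i.e. x ↦ F(x)^{s*} and x ↦ (1 − F(x))^{s*} are convex on J(F), so F is bi-s*-concave. -/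
open MeasureTheory Set Filter

section SConcaveDensity

/-- The rpow form of `s`-concavity on the positivity set, for `s < 0`, is convexity of `f ^ s`. -/
lemma convexOn_rpow_of_sConcave {s : ℝ} (hs : s < 0) {f : ℝ → ℝ}
    (h : ∀ x y θ : ℝ, 0 < f x → 0 < f y → θ ∈ Ioo (0 : ℝ) 1 →
      ((1 - θ) * f x ^ s + θ * f y ^ s) ^ (1 / s) ≤ f ((1 - θ) * x + θ * y)) :
    ConvexOn ℝ {x | 0 < f x} (fun x => f x ^ s) := by
  have key : ∀ x y a b : ℝ, 0 < f x → 0 < f y → 0 < a → 0 < b → a + b = 1 →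
      0 < f (a * x + b * y) ∧ f (a * x + b * y) ^ s ≤ a * f x ^ s + b * f y ^ s := by
    intro x y a b hx hy ha hb hab
    obtain rfl : a = 1 - b := by linarith
    have hpos : 0 < (1 - b) * f x ^ s + b * f y ^ s := by positivity
    have hle := h x y b hx hy ⟨hb, by linarith⟩
    have hfpos : 0 < f ((1 - b) * x + b * y) := (Real.rpow_pos_of_pos hpos _).trans_le hle
    rw [one_div, Real.rpow_inv_le_iff_of_neg hpos hfpos hs] at hle
    exact ⟨hfpos, hle⟩
  exact convexOn_iff_forall_pos.2
    ⟨convex_iff_forall_pos.2 fun x hx y hy a b ha hb hab => (key x y a b hx hy ha hb hab).1,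
      fun x hx y hy a b ha hb hab => (key x y a b hx hy ha hb hab).2⟩

/-- An antiderivative of a negative power of a decreasing affine function. -/
lemma hasDerivAt_affine_rpow_div {s m c v w : ℝ} (hs : s ≠ 0) (hs' : 1 + s ≠ 0) (hm : m ≠ 0)
    (hpos : 0 < c + m * (w - v)) :
    HasDerivAt (fun t => (c + m * (t - v)) ^ ((1 + s) / s) / (m * ((1 + s) / s)))
      ((c + m * (w - v)) ^ s⁻¹) w := by
  have h1 : HasDerivAt (fun t => c + m * (t - v)) m w := by
    simpa using (((hasDerivAt_id w).sub_const v).const_mul m).const_add c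
  have h2 := (h1.rpow_const (p := (1 + s) / s) (Or.inl hpos.ne')).div_const (m * ((1 + s) / s))
  rw [mul_div_cancel_left₀ _ (mul_ne_zero hm (div_ne_zero hs' hs)),
    show (1 + s) / s - 1 = s⁻¹ by field_simp; ring] at h2
  exact h2

/-- If `f ^ s` is convex where `f` is positive, then `f ^ (1 + s) / F` is nonincreasing, where
`F` is the integral of `f` over left half-lines. -/
lemma rpow_mul_integral_Iic_le {s : ℝ} (hs : s ∈ Ioo (-1 : ℝ) 0) {f : ℝ → ℝ}
    (hf0 : ∀ x, 0 ≤ f x) (hint : Integrable f)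
    (hconv : ConvexOn ℝ {x | 0 < f x} (fun x => f x ^ s)) {u v : ℝ} (huv : u ≤ v)
    (hu : 0 < f u) (hv : 0 < f v) :
    f v ^ (1 + s) * ∫ y in Iic u, f y ≤ f u ^ (1 + s) * ∫ y in Iic v, f y := by
  obtain ⟨hs1, hs0⟩ := hs
  have hs1' : 0 < 1 + s := by linarith
  have hsub : (∫ y in Iic v, f y) - ∫ y in Iic u, f y = ∫ y in u..v, f y :=
    intervalIntegral.integral_Iic_sub_Iic hint.integrableOn hint.integrableOn
  have hu0 : 0 ≤ ∫ y in Iic u, f y := integral_nonneg hf0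
  have huv0 : 0 ≤ ∫ y in u..v, f y := intervalIntegral.integral_nonneg huv fun x _ => hf0 x
  rcases le_or_gt (f v) (f u) with hle | hlt
  · exact mul_le_mul (Real.rpow_le_rpow hv.le hle hs1'.le) (by linarith) hu0
      (Real.rpow_nonneg hu.le _)
  have huv' : u < v := lt_of_le_of_ne huv (by rintro rfl; exact lt_irrefl _ hlt)
  set m : ℝ := (f v ^ s - f u ^ s) / (v - u) with hm_def
  have hm : m < 0 := div_neg_of_neg_of_pos
    (sub_neg.2 (Real.rpow_lt_rpow_of_neg hu hlt hs0)) (by linarith)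
  have hmu : f v ^ s + m * (u - v) = f u ^ s := by
    have : v - u ≠ 0 := by linarith
    rw [hm_def]; field_simp; ring
  set Φ : ℝ → ℝ := fun t => (f v ^ s + m * (t - v)) ^ ((1 + s) / s) / (m * ((1 + s) / s))
  have hc : 0 < m * ((1 + s) / s) :=
    mul_pos_of_neg_of_neg hm (div_neg_of_pos_of_neg hs1' hs0)
  have hpos : ∀ w ≤ v, 0 < f v ^ s + m * (w - v) := fun w hw => by
    have : 0 < f v ^ s := by positivity
    nlinarith
  have hpow : ∀ x, 0 < f x → (f x ^ s) ^ ((1 + s) / s) = f x ^ (1 + s) := fun x hx => by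
    rw [← Real.rpow_mul hx.le, mul_div_cancel₀ _ hs0.ne]
  have hΦu : Φ u = f u ^ (1 + s) / (m * ((1 + s) / s)) := by simp only [Φ, hmu, hpow u hu]
  have hΦv : Φ v = f v ^ (1 + s) / (m * ((1 + s) / s)) := by
    simp only [Φ, sub_self, mul_zero, add_zero, hpow v hv]
  have hcont : ∀ a b, a ≤ b → b ≤ v →
      IntervalIntegrable (fun t => (f v ^ s + m * (t - v)) ^ s⁻¹) volume a b := by
    intro a b hab hbv
    refine ContinuousOn.intervalIntegrable fun w hw => ?_
    rw [uIcc_of_le hab] at hw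
    refine (ContinuousAt.rpow_const (by fun_prop) (Or.inl ?_)).continuousWithinAt
    exact (hpos w (hw.2.trans hbv)).ne'
  have hFTC : ∀ a b, a ≤ b → b ≤ v →
      ∫ t in a..b, (f v ^ s + m * (t - v)) ^ s⁻¹ = Φ b - Φ a := by
    intro a b hab hbv
    refine intervalIntegral.integral_eq_sub_of_hasDerivAt (fun w hw => ?_) (hcont a b hab hbv)
    rw [uIcc_of_le hab] at hw
    exact hasDerivAt_affine_rpow_div hs0.ne hs1'.ne' hm.ne (hpos w (hw.2.trans hbv))
  have hleft : ∫ y in Iic u, f y ≤ Φ u := by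
    refine le_of_tendsto (intervalIntegral_tendsto_integral_Iic u hint.integrableOn tendsto_id) ?_
    filter_upwards [eventually_le_atBot u] with a ha
    have hΦa : 0 ≤ Φ a := div_nonneg (Real.rpow_nonneg (hpos a (ha.trans huv)).le _) hc.le
    calc ∫ y in a..u, f y ≤ ∫ t in a..u, (f v ^ s + m * (t - v)) ^ s⁻¹ := by
          refine intervalIntegral.integral_mono_on ha hint.intervalIntegrable
            (hcont a u ha huv) fun w hw => ?_
          rcases (hf0 w).eq_or_lt with h0 | h0
          · rw [← h0]; exact Real.rpow_nonneg (hpos w (hw.2.trans huv)).le _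
          rw [Real.le_rpow_inv_iff_of_neg h0 (hpos w (hw.2.trans huv)) hs0]
          rcases hw.2.eq_or_lt with rfl | hwu
          · exact hmu.le
          have hsl := hconv.slope_mono_adjacent h0 hv hwu huv'
          rw [← hm_def, div_le_iff₀ (by linarith)] at hsl
          linarith
      _ = Φ u - Φ a := hFTC a u ha huv
      _ ≤ Φ u := by linarith
  have hright : Φ v - Φ u ≤ ∫ y in u..v, f y := by
    rw [← hFTC u v huv le_rfl]
    refine intervalIntegral.integral_mono_on huv (hcont u v huv le_rfl)
      hint.intervalIntegrable fun w hw => ?_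
    have h0 : 0 < f w := hconv.1.ordConnected.out hu hv hw
    rw [Real.rpow_inv_le_iff_of_neg (hpos w hw.2) h0 hs0]
    rcases hw.1.eq_or_lt with rfl | hwu
    · exact hmu.ge
    have hsl := hconv.secant_mono hu h0 hv hwu.ne' huv'.ne' hw.2
    rw [← hm_def, div_le_iff₀ (by linarith)] at hsl
    linarith
  have hlt' := Real.rpow_le_rpow hu.le hlt.le hs1'.le
  rw [hΦu, le_div_iff₀ hc] at hleft
  rw [hΦu, hΦv, ← sub_div, div_le_iff₀ hc] at hright
  have hfu : (0 : ℝ) ≤ f u ^ (1 + s) := by positivity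
  have h1 := mul_le_mul_of_nonneg_left hleft (sub_nonneg.2 hlt')
  have h2 := mul_le_mul_of_nonneg_left hright hfu
  have h3 : 0 ≤ (f u ^ (1 + s) * (∫ y in u..v, f y) -
      (f v ^ (1 + s) - f u ^ (1 + s)) * ∫ y in Iic u, f y) * (m * ((1 + s) / s)) := by linarith
  have h4 := nonneg_of_mul_nonneg_left h3 hc
  rw [← hsub] at h4
  linarith

/-- The distribution function `F` of an `s`-concave probability density is `s / (1 + s)`-concave
on `{0 < F < 1}`. -/
lemma convexOn_integral_Iic_rpow {s : ℝ} (hs : s ∈ Ioo (-1 : ℝ) 0) {f : ℝ → ℝ}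
    (hf0 : ∀ x, 0 ≤ f x) (htot : ∫ x, f x = 1)
    (hconv : ConvexOn ℝ {x | 0 < f x} (fun x => f x ^ s)) :
    ConvexOn ℝ {z : ℝ | 0 < (∫ y in Iic z, f y) ∧ (∫ y in Iic z, f y) < 1}
      (fun z => (∫ y in Iic z, f y) ^ (s / (1 + s))) := by
  have hs1' : 0 < 1 + s := by linarith [hs.1]
  have hint : Integrable f := by
    by_contra h
    simp [integral_undef h] at htot
  set F : ℝ → ℝ := fun z => ∫ y in Iic z, f y with hF
  set J : Set ℝ := {z | 0 < F z ∧ F z < 1} with hJ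
  have hsub : ∀ a b, F b - F a = ∫ y in a..b, f y := fun a b =>
    intervalIntegral.integral_Iic_sub_Iic hint.integrableOn hint.integrableOn
  have hFeq : F = fun z => (∫ y in (0 : ℝ)..z, f y) + F 0 := by
    ext z; rw [← hsub]; ring
  have hmono : Monotone F := fun a b hab => by
    have := intervalIntegral.integral_nonneg (μ := volume) hab fun x _ => hf0 x
    linarith [hsub a b]
  have hFcont : Continuous F := by
    rw [hFeq]
    exact (intervalIntegral.continuous_primitive
      (fun _ _ => hint.intervalIntegrable) 0).add continuous_const
  have hJopen : IsOpen J :=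
    (isOpen_lt continuous_const hFcont).inter (isOpen_lt hFcont continuous_const)
  have hJconv : Convex ℝ J := by
    refine OrdConnected.convex ⟨fun a ha b hb c hc => ?_⟩
    exact ⟨ha.1.trans_le (hmono hc.1), (hmono hc.2).trans_lt hb.2⟩
  have hJpos : J ⊆ {x | 0 < f x} := by
    intro x hx
    have hadd : F x + ∫ y in Ioi x, f y = 1 := by
      rw [← htot]
      exact intervalIntegral.integral_Iic_add_Ioi hint.integrableOn hint.integrableOn
    obtain ⟨a, ha, hfa⟩ : ∃ a ∈ Iic x, f a ≠ 0 := by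
      by_contra! h
      exact hx.1.ne' (setIntegral_eq_zero_of_forall_eq_zero h)
    obtain ⟨b, hb, hfb⟩ : ∃ b ∈ Ioi x, f b ≠ 0 := by
      by_contra! h
      rw [setIntegral_eq_zero_of_forall_eq_zero h] at hadd
      linarith [hx.2]
    exact hconv.1.ordConnected.out ((hf0 a).lt_of_ne' hfa) ((hf0 b).lt_of_ne' hfb)
      ⟨ha, (mem_Ioi.1 hb).le⟩
  have hfcont : ContinuousOn f J := by
    have h1 := (hconv.subset hJpos hJconv).continuousOn hJopen
    have h2 : ContinuousOn (fun x => (f x ^ s) ^ s⁻¹) J :=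
      h1.rpow_const fun x hx => Or.inl (Real.rpow_pos_of_pos (hJpos hx) _).ne'
    refine h2.congr fun x _ => ?_
    exact (Real.rpow_rpow_inv (hf0 x) hs.2.ne).symm
  have hderivF : ∀ x ∈ J, HasDerivAt F (f x) x := by
    intro x hx
    rw [hFeq]
    exact (intervalIntegral.integral_hasDerivAt_right hint.intervalIntegrable
      hint.aestronglyMeasurable.stronglyMeasurableAtFilter
      (hfcont.continuousAt (hJopen.mem_nhds hx))).add_const _
  have hderiv : ∀ x ∈ J, HasDerivAt (fun z => F z ^ (s / (1 + s)))
      (f x * (s / (1 + s)) * F x ^ (s / (1 + s) - 1)) x := fun x hx =>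
    (hderivF x hx).rpow_const (Or.inl hx.1.ne')
  refine MonotoneOn.convexOn_of_deriv hJconv
    (fun x hx => (hderiv x hx).continuousAt.continuousWithinAt) ?_ ?_ <;> rw [hJopen.interior_eq]
  · exact fun x hx => (hderiv x hx).differentiableAt.differentiableWithinAt
  intro u hu v hv huv
  rw [(hderiv u hu).deriv, (hderiv v hv).deriv]
  have hexp : s / (1 + s) - 1 = -(1 + s)⁻¹ := by field_simp; ring
  have hroot : ∀ x y, x ∈ J → y ∈ J →
      (f x ^ (1 + s) * F y) ^ (1 + s)⁻¹ = f x * F y ^ (1 + s)⁻¹ := fun x y _ hy => by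
    rw [Real.mul_rpow (Real.rpow_nonneg (hf0 x) _) hy.1.le, Real.rpow_rpow_inv (hf0 x) hs1'.ne']
  have hle := Real.rpow_le_rpow (mul_nonneg (Real.rpow_nonneg (hf0 v) _) hu.1.le)
    (rpow_mul_integral_Iic_le hs hf0 hint hconv huv (hJpos hu) (hJpos hv))
    (inv_nonneg.2 hs1'.le)
  rw [hroot v u hv hu, hroot u v hu hv] at hle
  have hFu : 0 < F u ^ (1 + s)⁻¹ := Real.rpow_pos_of_pos hu.1 _
  have hFv : 0 < F v ^ (1 + s)⁻¹ := Real.rpow_pos_of_pos hv.1 _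
  have hq : s / (1 + s) ≤ 0 := div_nonpos_of_nonpos_of_nonneg hs.2.le hs1'.le
  have hle' : f v * F v ^ (-(1 + s)⁻¹) ≤ f u * F u ^ (-(1 + s)⁻¹) := by
    rw [Real.rpow_neg hu.1.le, Real.rpow_neg hv.1.le, ← div_eq_mul_inv, ← div_eq_mul_inv,
      div_le_div_iff₀ hFv hFu]
    exact hle
  rw [hexp]
  linarith [mul_le_mul_of_nonpos_left hle' hq]

end SConcaveDensity

/-- Let `s ∈ (-1,0)` and `s* = s/(1+s) < 0`. If `f` is an `s`-concave
probability density on `ℝ` with distribution function `F x = ∫_{-∞}^x f`, then `F` and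
`1 - F` are `s*`-concave on `J(F)`: the maps `x ↦ F(x)^{s*}` and `x ↦ (1 - F(x))^{s*}`
are convex on `J(F)`, i.e. `F` is bi-`s*`-concave. -/
theorem sConcave_density_implies_bi_sStar_concave
    (s : ℝ) (hs : s ∈ Set.Ioo (-1 : ℝ) 0)
    (f F : ℝ → ℝ)
    (hf_nonneg : ∀ x, 0 ≤ f x)
    (hf_total : ∫ x, f x = 1)
    (hf_sconcave : ∀ x y θ : ℝ, 0 < f x → 0 < f y → θ ∈ Set.Ioo (0 : ℝ) 1 →
      ((1 - θ) * f x ^ s + θ * f y ^ s) ^ (1 / s) ≤ f ((1 - θ) * x + θ * y))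
    (hF : ∀ x, F x = ∫ y in Set.Iic x, f y) :
    ∀ x ∈ {z : ℝ | 0 < F z ∧ F z < 1}, ∀ y ∈ {z : ℝ | 0 < F z ∧ F z < 1},
      ∀ θ ∈ Set.Ioo (0 : ℝ) 1,
        F ((1 - θ) * x + θ * y) ^ (s / (1 + s)) ≤
            (1 - θ) * F x ^ (s / (1 + s)) + θ * F y ^ (s / (1 + s)) ∧
        (1 - F ((1 - θ) * x + θ * y)) ^ (s / (1 + s)) ≤
            (1 - θ) * (1 - F x) ^ (s / (1 + s)) + θ * (1 - F y) ^ (s / (1 + s)) := by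
  have hconv := convexOn_rpow_of_sConcave hs.2 hf_sconcave
  have hconv' : ConvexOn ℝ {x | 0 < f (-x)} (fun x => f (-x) ^ s) := by
    refine convexOn_rpow_of_sConcave (f := fun x => f (-x)) hs.2 fun x y θ hx hy hθ => ?_
    convert hf_sconcave (-x) (-y) θ hx hy hθ using 2
    ring
  have hint : Integrable f := by
    by_contra h
    simp [integral_undef h] at hf_total
  have hrefl : ∀ x, 1 - F x = ∫ y in Iic (-x), f (-y) := fun x => by
    rw [integral_comp_neg_Iic, neg_neg, hF, ← hf_total,
      ← intervalIntegral.integral_Iic_add_Ioi (b := x) hint.integrableOn hint.integrableOn]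
    ring
  have hleft := convexOn_integral_Iic_rpow hs hf_nonneg hf_total hconv
  have hright := convexOn_integral_Iic_rpow hs (fun x => hf_nonneg (-x))
    ((integral_neg_eq_self f volume).trans hf_total) hconv'
  simp only [← hF] at hleft
  have hmem : ∀ z, 0 < F z ∧ F z < 1 → -z ∈ {z : ℝ | 0 < (∫ y in Iic z, f (-y)) ∧
      (∫ y in Iic z, f (-y)) < 1} := fun z hz => by
    rw [mem_ofPred_eq, ← hrefl]
    constructor <;> linarith [hz.1, hz.2]
  intro x hx y hy θ hθ
  refine ⟨hleft.2 hx hy (sub_nonneg.2 hθ.2.le) hθ.1.le (by ring), ?_⟩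
  have h := hright.2 (hmem x hx) (hmem y hy) (sub_nonneg.2 hθ.2.le) hθ.1.le (by ring)
  simp only [smul_eq_mul] at h
  rw [show (1 - θ) * -x + θ * -y = -((1 - θ) * x + θ * y) by ring] at h
  simpa only [← hrefl] using h
end

section
/- Let s ∈ (0, ∞) and set s* = s/(1+s) ∈ (0, 1). Let f be a probability density on ℝ that vanishes outside an interval with endpoints a = inf J(F) and b = sup J(F) and is s-concave, i.e. f((1−θ)x + θy)^{s} ≥ (1−θ) f(x)^{s} + θ f(y)^{s} for all x, y with f(x), f(y) > 0 and θ ∈ (0,1), and let F(x) = ∫_{−∞}^{x} f(y) dy. Then x ↦ F(x)^{s*} is concave on (a, ∞) and x ↦ (1 − F(x))^{s*} is concave on (−∞, b); i.e. F is bi-s*-concave. -/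
open MeasureTheory Set Filter

/-- A concave function on an open interval, scaled about the zero of one of its increasing chords,
lies below its rescaling. -/
theorem ConcaveOn.le_mul_of_contract {g : ℝ → ℝ} {a b x y c u : ℝ}
    (hg : ConcaveOn ℝ (Ioo a b) g) (hpos : ∀ t ∈ Ioo a b, 0 < g t)
    (hx : x ∈ Ioo a b) (hy : y ∈ Ioo a b) (hxy : x < y) (hc0 : 0 < c) (hc1 : c < 1)
    (hc : g x = c * g y) (hu : u < y) (hT : x - c * (y - u) ∈ Ioo a b) :
    u ∈ Ioo a b ∧ g (x - c * (y - u)) ≤ c * g u := by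
  set v := x - c * (y - u) with hv
  have hvx : v < x := by nlinarith
  obtain ⟨m, hm⟩ : ∃ m, m * (y - x) = (1 - c) * g y :=
    ⟨(1 - c) * g y / (y - x), div_mul_cancel₀ _ (by linarith)⟩
  have hm0 : 0 < m := by
    have : 0 < m * (y - x) := hm ▸ mul_pos (by linarith) (hpos y hy)
    exact pos_of_mul_pos_left this (by linarith)
  have chord : ∀ {p q r : ℝ}, p ∈ Ioo a b → r ∈ Ioo a b → p < q → q < r →
      (g r - g q) * (q - p) ≤ (g q - g p) * (r - q) := fun hp hr hpq hqr => by
    have := hg.slope_anti_adjacent hp hr hpq hqr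
    rwa [div_le_div_iff₀ (by linarith) (by linarith)] at this
  have hslope : g y - g x = m * (y - x) := by rw [hm, hc]; ring
  have below : ∀ t ∈ Ioo a b, t < x → g t ≤ g y - m * (y - t) := fun t ht htx => by
    have h := chord ht hy htx hxy
    rw [hslope] at h
    have : m * (x - t) ≤ g x - g t := by
      refine le_of_mul_le_mul_right (a := y - x) ?_ (by linarith)
      linarith
    linarith
  have hgap : m * (u - v) = (1 - c) * (g y - m * (y - u)) := by
    rw [hv]; linear_combination hm
  have hvle := below v hT hvx
  have hvu : v < u := by
    by_contra! h
    have h1 : (1 - c) * (g y - m * (y - u)) ≤ 0 := by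
      rw [← hgap]; exact mul_nonpos_of_nonneg_of_nonpos hm0.le (by linarith)
    have h2 : g y - m * (y - u) ≤ 0 := by
      by_contra! h; exact absurd (mul_pos (sub_pos.2 hc1) h) (not_lt.2 h1)
    have h3 : g y - m * (y - v) = c * (g y - m * (y - u)) := by linear_combination (-1) * hgap
    nlinarith [hpos v hT]
  have huI : u ∈ Ioo a b := ⟨hT.1.trans hvu, hu.trans hy.2⟩
  refine ⟨huI, ?_⟩
  have hline : g y - m * (y - v) = c * (g y - m * (y - u)) := by linear_combination (-1) * hgap
  rcases lt_trichotomy u x with hux | rfl | hxu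
  · have h1 := chord hT hx hvu hux
    have h2 := chord huI hy hux hxy
    rw [hslope] at h2
    have h3 : m * (x - u) ≤ g x - g u := by
      refine le_of_mul_le_mul_right (a := y - x) ?_ (by linarith)
      linarith
    have h4 : m * (u - v) ≤ g u - g v := by
      refine le_of_mul_le_mul_right (a := x - u) ?_ (by linarith)
      nlinarith [mul_le_mul_of_nonneg_right h3 (sub_pos.2 hvu).le]
    have h5 := below u huI hux
    nlinarith [mul_le_mul_of_nonneg_left h5 (sub_pos.2 hc1).le]
  · have : g y - m * (y - u) = g u := by linarith
    rw [this] at hline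
    linarith
  · have h1 := chord hx hy hxu hu
    have h2 : g y - m * (y - u) ≤ g u := by
      refine le_of_mul_le_mul_right (a := y - x) ?_ (by linarith)
      have : g x = g y - m * (y - x) := by linarith
      rw [this] at h1
      nlinarith
    nlinarith [mul_le_mul_of_nonneg_left h2 hc0.le]

section Density

variable {f : ℝ → ℝ} {a b s : ℝ}

theorem integral_Iic_mul_rpow_le (hs : 0 < s) (hfi : Integrable f)
    (hpos : ∀ t ∈ Ioo a b, 0 < f t) (hzero : ∀ t ∉ Ioo a b, f t = 0)
    (hconc : ConcaveOn ℝ (Ioo a b) fun t => f t ^ s) {x y : ℝ}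
    (hx : x ∈ Ioo a b) (hy : y ∈ Ioo a b) (hxy : x < y) :
    (∫ t in Iic x, f t) * f y ^ (1 + s) ≤ (∫ t in Iic y, f t) * f x ^ (1 + s) := by
  have hnonneg : ∀ t, 0 ≤ f t := fun t => by
    by_cases h : t ∈ Ioo a b
    exacts [(hpos t h).le, (hzero t h).ge]
  have hfx := hpos x hx
  have hfy := hpos y hy
  rcases le_or_gt (f y) (f x) with hle | hlt
  · have hmono : ∫ t in Iic x, f t ≤ ∫ t in Iic y, f t :=
      setIntegral_mono_set hfi.integrableOn (Eventually.of_forall hnonneg)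
        (Iic_subset_Iic.2 hxy.le).eventuallyLE
    have := setIntegral_nonneg (μ := volume) (measurableSet_Iic (a := y)) fun t _ => hnonneg t
    gcongr
  set r := f x / f y with hr
  have hr0 : 0 < r := div_pos hfx hfy
  have hr1 : r < 1 := (div_lt_one hfy).2 hlt
  have hfxr : f x = r * f y := by rw [hr]; field_simp
  set c := r ^ s with hcdef
  have hc0 : 0 < c := Real.rpow_pos_of_pos hr0 s
  have hc1 : c < 1 := Real.rpow_lt_one hr0.le hr1 hs
  have key : ∀ u < y, f (x - c * (y - u)) ≤ r * f u := fun u hu => by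
    by_cases hT : x - c * (y - u) ∈ Ioo a b
    · obtain ⟨huI, h⟩ := hconc.le_mul_of_contract (fun t ht => Real.rpow_pos_of_pos (hpos t ht) s)
        hx hy hxy hc0 hc1 (by simp only [hfxr]; rw [Real.mul_rpow hr0.le hfy.le]) hu hT
      simp only [hcdef] at h hT ⊢
      rw [← Real.mul_rpow hr0.le (hnonneg u)] at h
      exact (Real.rpow_le_rpow_iff (hnonneg _) (mul_nonneg hr0.le (hnonneg u)) hs).1 h
    · rw [hzero _ hT]
      exact mul_nonneg hr0.le (hnonneg u)
  have hcomp : ∀ u, x - c * (y - u) = c * u + (x - c * y) := fun u => by ring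
  have hsubst : ∫ t in Iic x, f t = c * ∫ u in Iic y, f (x - c * (y - u)) := by
    rw [← integral_indicator measurableSet_Iic, ← integral_indicator measurableSet_Iic]
    have h1 := Measure.integral_comp_mul_left
      (fun t => (Iic x).indicator f (t + (x - c * y))) c
    rw [integral_add_right_eq_self (fun t => (Iic x).indicator f t)] at h1
    have h2 : (fun u => (Iic y).indicator (fun u => f (x - c * (y - u))) u) =
        fun u => (Iic x).indicator f (c * u + (x - c * y)) := by
      funext u
      have : c * u + (x - c * y) ≤ x ↔ u ≤ y := by
        constructor <;> intro h <;> nlinarith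
      simp only [indicator, mem_Iic, this, hcomp]
    rw [h2, h1, abs_of_pos (inv_pos.2 hc0), smul_eq_mul, mul_inv_cancel_left₀ hc0.ne']
  have hbound : ∫ u in Iic y, f (x - c * (y - u)) ≤ r * ∫ u in Iic y, f u := by
    rw [← integral_const_mul, integral_Iic_eq_integral_Iio, integral_Iic_eq_integral_Iio]
    refine setIntegral_mono_on ?_ (hfi.const_mul r).integrableOn measurableSet_Iio key
    simp only [hcomp]
    exact ((hfi.comp_add_right (x - c * y)).comp_mul_left' hc0.ne').integrableOn
  have hF : ∫ t in Iic x, f t ≤ r ^ (1 + s) * ∫ u in Iic y, f u := by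
    rw [hsubst, Real.rpow_add hr0, Real.rpow_one]
    nlinarith
  rw [hfxr, Real.mul_rpow hr0.le hfy.le]
  have := mul_le_mul_of_nonneg_right hF (Real.rpow_nonneg hfy.le (1 + s))
  linarith

theorem integral_Iic_pos (hfi : Integrable f) (hpos : ∀ t ∈ Ioo a b, 0 < f t)
    (hnonneg : ∀ t, 0 ≤ f t) {x : ℝ} (hx : x ∈ Ioo a b) : 0 < ∫ t in Iic x, f t := by
  have h1 : 0 < ∫ t in a..x, f t :=
    intervalIntegral.intervalIntegral_pos_of_pos_on hfi.intervalIntegrable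
      (fun t ht => hpos t ⟨ht.1, ht.2.trans hx.2⟩) hx.1
  rw [intervalIntegral.integral_of_le hx.1.le] at h1
  exact h1.trans_le (setIntegral_mono_set hfi.integrableOn (Eventually.of_forall hnonneg)
    Ioc_subset_Iic_self.eventuallyLE)

theorem integral_Iic_eq_add_intervalIntegral (hfi : Integrable f) (a x : ℝ) :
    ∫ t in Iic x, f t = (∫ t in Iic a, f t) + ∫ t in a..x, f t := by
  rw [← intervalIntegral.integral_Iic_sub_Iic hfi.integrableOn hfi.integrableOn]
  ring

theorem continuous_integral_Iic (hfi : Integrable f) : Continuous fun x => ∫ t in Iic x, f t := by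
  rw [funext (integral_Iic_eq_add_intervalIntegral hfi 0)]
  exact continuous_const.add
    (intervalIntegral.continuous_primitive (fun _ _ => hfi.intervalIntegrable) 0)

theorem concaveOn_Icc_integral_Iic_rpow (hs : 0 < s) (hfi : Integrable f)
    (hpos : ∀ t ∈ Ioo a b, 0 < f t) (hzero : ∀ t ∉ Ioo a b, f t = 0)
    (hconc : ConcaveOn ℝ (Ioo a b) fun t => f t ^ s) :
    ConcaveOn ℝ (Icc a b) fun x => (∫ t in Iic x, f t) ^ (s / (1 + s)) := by
  have hnonneg : ∀ t, 0 ≤ f t := fun t => by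
    by_cases h : t ∈ Ioo a b
    exacts [(hpos t h).le, (hzero t h).ge]
  have hs1 : 0 < 1 + s := by linarith
  have hcont : ContinuousOn f (Ioo a b) := by
    refine ((hconc.continuousOn isOpen_Ioo).rpow_const (p := s⁻¹)
      fun t _ => Or.inr (inv_pos.2 hs).le).congr fun t _ => ?_
    simp only [Real.rpow_rpow_inv (hnonneg t) hs.ne']
  have hFpos : ∀ x ∈ Ioo a b, 0 < ∫ t in Iic x, f t := fun x hx =>
    integral_Iic_pos hfi hpos hnonneg hx
  have hderiv : ∀ x ∈ Ioo a b, HasDerivAt (fun x => (∫ t in Iic x, f t) ^ (s / (1 + s)))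
      (f x * (s / (1 + s)) * (∫ t in Iic x, f t) ^ (s / (1 + s) - 1)) x := fun x hx => by
    refine HasDerivAt.rpow_const ?_ (Or.inl (hFpos x hx).ne')
    rw [funext (integral_Iic_eq_add_intervalIntegral hfi a)]
    exact (intervalIntegral.integral_hasDerivAt_right hfi.intervalIntegrable
      (hfi.aestronglyMeasurable.stronglyMeasurableAtFilter)
      (hcont.continuousAt (isOpen_Ioo.mem_nhds hx))).const_add _
  refine AntitoneOn.concaveOn_of_deriv (convex_Icc a b)
    ((continuous_integral_Iic hfi).rpow_const fun _ => Or.inr (by positivity)).continuousOn ?_ ?_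
  · rw [interior_Icc]
    exact fun x hx => (hderiv x hx).differentiableAt.differentiableWithinAt
  rw [interior_Icc]
  intro x hx y hy hxy
  rw [(hderiv x hx).deriv, (hderiv y hy).deriv]
  rcases hxy.eq_or_lt with rfl | hxy
  · rfl
  have h := integral_Iic_mul_rpow_le hs hfi hpos hzero hconc hx hy hxy
  have hFx := hFpos x hx
  have hFy := hFpos y hy
  have hroot := Real.rpow_le_rpow (by have := hnonneg y; positivity) h (inv_pos.2 hs1).le
  rw [Real.mul_rpow hFx.le (Real.rpow_nonneg (hnonneg y) _),
    Real.mul_rpow hFy.le (Real.rpow_nonneg (hnonneg x) _),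
    Real.rpow_rpow_inv (hnonneg y) hs1.ne', Real.rpow_rpow_inv (hnonneg x) hs1.ne'] at hroot
  have hexp : s / (1 + s) - 1 = -(1 + s)⁻¹ := by field_simp; ring
  rw [hexp, Real.rpow_neg hFx.le, Real.rpow_neg hFy.le, ← div_eq_mul_inv, ← div_eq_mul_inv,
    div_le_div_iff₀ (by positivity) (by positivity)]
  have := mul_le_mul_of_nonneg_left hroot (show 0 ≤ s / (1 + s) by positivity)
  linarith

theorem concaveOn_Ioi_integral_Iic_rpow (hs : 0 < s) (hab : a < b) (hfi : Integrable f)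
    (hpos : ∀ t ∈ Ioo a b, 0 < f t) (hzero : ∀ t ∉ Icc a b, f t = 0)
    (hconc : ConcaveOn ℝ (Ioo a b) fun t => f t ^ s) :
    ConcaveOn ℝ (Ioi a) fun x => (∫ t in Iic x, f t) ^ (s / (1 + s)) := by
  set g := (Ioo a b).indicator f with hg
  have hgf : ∀ t ∈ Ioo a b, g t = f t := fun t ht => indicator_of_mem ht f
  have hgzero : ∀ t ∉ Ioo a b, g t = 0 := fun t ht => indicator_of_notMem ht f
  have hae : f =ᵐ[volume] g := by
    have hIcc : (Icc a b).indicator f = f := by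
      funext t
      by_cases h : t ∈ Icc a b
      · exact indicator_of_mem h f
      · rw [indicator_of_notMem h, hzero t h]
    have := indicator_ae_eq_of_ae_eq_set (f := f) (Ioo_ae_eq_Icc (μ := volume) (a := a) (b := b))
    rw [hIcc] at this
    exact this.symm
  have hF : ∀ x, ∫ t in Iic x, f t = ∫ t in Iic x, g t := fun x =>
    integral_congr_ae (ae_restrict_of_ae hae)
  have hgnonneg : ∀ t, 0 ≤ g t := indicator_nonneg fun t ht => (hpos t ht).le
  have hgint : Integrable g := hfi.congr hae
  have hIcc := concaveOn_Icc_integral_Iic_rpow hs hgint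
    (fun t ht => by rw [hgf t ht]; exact hpos t ht) hgzero
    (hconc.congr fun t ht => by simp only [hgf t ht])
  have hmin : ∀ x, ∫ t in Iic x, g t = ∫ t in Iic (min x b), g t := fun x => by
    rw [← setIntegral_eq_of_subset_of_forall_sdiff_eq_zero measurableSet_Iic
      (Iic_subset_Iic.2 (min_le_left x b)) fun t ht => hgzero t fun h => ht.2 ?_]
    exact le_min ht.1 h.2.le
  have hmono : Monotone fun x => (∫ t in Iic x, g t) ^ (s / (1 + s)) := fun x y hxy =>
    Real.rpow_le_rpow (setIntegral_nonneg measurableSet_Iic fun t _ => hgnonneg t)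
      (setIntegral_mono_set hgint.integrableOn (Eventually.of_forall hgnonneg)
        (Iic_subset_Iic.2 hxy).eventuallyLE) (by positivity)
  simp only [hF]
  have hmem : ∀ x ∈ Ioi a, min x b ∈ Icc a b := fun x hx =>
    ⟨le_min (le_of_lt hx) hab.le, min_le_right x b⟩
  refine ⟨convex_Ioi a, fun x hx y hy α β hα hβ hαβ => ?_⟩
  have h := hIcc.2 (hmem x hx) (hmem y hy) hα hβ hαβ
  simp only [hmin x, hmin y]
  refine h.trans ?_
  simp only [hmin (α • x + β • y)]
  refine hmono (le_min ?_ ?_)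
  · exact add_le_add (mul_le_mul_of_nonneg_left (min_le_left x b) hα)
      (mul_le_mul_of_nonneg_left (min_le_left y b) hβ)
  · calc α • min x b + β • min y b ≤ α * b + β * b :=
        add_le_add (mul_le_mul_of_nonneg_left (min_le_right x b) hα)
          (mul_le_mul_of_nonneg_left (min_le_right y b) hβ)
      _ = b := by rw [← add_mul, hαβ, one_mul]

theorem concaveOn_Iio_integral_Ioi_rpow (hs : 0 < s) (hab : a < b) (hfi : Integrable f)
    (hpos : ∀ t ∈ Ioo a b, 0 < f t) (hzero : ∀ t ∉ Icc a b, f t = 0)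
    (hconc : ConcaveOn ℝ (Ioo a b) fun t => f t ^ s) :
    ConcaveOn ℝ (Iio b) fun x => (∫ t in Ioi x, f t) ^ (s / (1 + s)) := by
  have hmem : ∀ t, -t ∈ Ioo a b ↔ t ∈ Ioo (-b) (-a) := fun t => by
    simp only [mem_Ioo, lt_neg, neg_lt, and_comm]
  have h := concaveOn_Ioi_integral_Iic_rpow (f := fun t => f (-t)) hs (neg_lt_neg hab)
    hfi.comp_neg (fun t ht => hpos _ ((hmem t).2 ht))
    (fun t ht => hzero _ fun h => ht ⟨by linarith [h.2], by linarith [h.1]⟩)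
    ⟨convex_Ioo _ _, fun x hx y hy α β hα hβ hαβ => by
      have := hconc.2 ((hmem x).2 hx) ((hmem y).2 hy) hα hβ hαβ
      simpa only [smul_neg, ← neg_add] using this⟩
  refine ⟨convex_Iio b, fun x hx y hy α β hα hβ hαβ => ?_⟩
  have := h.2 (mem_Ioi.2 (neg_lt_neg hx)) (mem_Ioi.2 (neg_lt_neg hy)) hα hβ hαβ
  simpa only [integral_comp_neg_Iic, smul_neg, ← neg_add, neg_neg] using this

end Density

/-- Let `s ∈ (0,∞)` and `s* = s/(1+s) ∈ (0,1)`. If `f` is an `s`-concave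
probability density vanishing outside an interval with endpoints `a = inf J(F)` and
`b = sup J(F)`, with distribution function `F x = ∫_{-∞}^x f`, then `x ↦ F(x)^{s*}` is
concave on `(a,∞)` and `x ↦ (1 - F(x))^{s*}` is concave on `(-∞,b)`; i.e. `F` is
bi-`s*`-concave. -/
theorem sConcave_density_implies_bi_sStar_concave_pos
    (s : ℝ) (hs : 0 < s)
    (f F : ℝ → ℝ) (a b : ℝ)
    (hf_nonneg : ∀ x, 0 ≤ f x)
    (hf_total : ∫ x, f x = 1)
    (hF : ∀ x, F x = ∫ y in Set.Iic x, f y)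
    (ha : a = sInf {x : ℝ | 0 < F x ∧ F x < 1})
    (hb : b = sSup {x : ℝ | 0 < F x ∧ F x < 1})
    (hf_supp : ∀ x ∉ Set.Icc a b, f x = 0)
    (hf_sconcave : ∀ x y θ : ℝ, 0 < f x → 0 < f y → θ ∈ Set.Ioo (0 : ℝ) 1 →
      (1 - θ) * f x ^ s + θ * f y ^ s ≤ f ((1 - θ) * x + θ * y) ^ s) :
    ConcaveOn ℝ (Set.Ioi a) (fun x => F x ^ (s / (1 + s))) ∧
    ConcaveOn ℝ (Set.Iio b) (fun x => (1 - F x) ^ (s / (1 + s))) := by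
  have hfi : Integrable f := by
    by_contra h
    rw [integral_undef h] at hf_total
    exact zero_ne_one hf_total
  have hcont : Continuous F := by
    rw [funext hF]; exact continuous_integral_Iic hfi
  have hmono : Monotone F := fun x y hxy => by
    rw [hF, hF]
    exact setIntegral_mono_set hfi.integrableOn (Eventually.of_forall hf_nonneg)
      (Iic_subset_Iic.2 hxy).eventuallyLE
  have hF_one : ∀ c, (∀ x, c < x → f x = 0) → F c = 1 := fun c hc => by
    rw [hF, ← hf_total]
    exact setIntegral_eq_integral_of_forall_compl_eq_zero fun x hx => hc x (not_le.1 hx)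
  have hF_zero : ∀ c, (∀ x, x < c → f x = 0) → F c = 0 := fun c hc => by
    rw [hF, integral_Iic_eq_integral_Iio]
    exact setIntegral_eq_zero_of_forall_eq_zero hc
  have hFa : F a = 0 := hF_zero a fun x hx => hf_supp x fun h => not_lt.2 h.1 hx
  have hFb : F b = 1 := hF_one b fun x hx => hf_supp x fun h => not_lt.2 h.2 hx
  have hab : a < b := by
    by_contra! h
    linarith [hmono h]
  have hJ : {x : ℝ | 0 < F x ∧ F x < 1}.Nonempty := by
    obtain ⟨x, hx⟩ := mem_range_of_exists_le_of_exists_ge (c := (1 / 2 : ℝ)) hcont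
      ⟨a, by linarith⟩ ⟨b, by linarith⟩
    exact ⟨x, by constructor <;> linarith⟩
  have hpos : ∀ c ∈ Ioo a b, 0 < f c := fun c hc => by
    have hFc0 : 0 < F c := by
      by_contra! h
      refine not_le.2 hc.1 (ha ▸ le_csInf hJ fun j hj => ?_)
      by_contra! hjc
      linarith [hj.1, hmono hjc.le]
    have hFc1 : F c < 1 := by
      by_contra! h
      refine not_le.2 hc.2 (hb ▸ csSup_le hJ fun j hj => ?_)
      by_contra! hjc
      linarith [hj.2, hmono hjc.le]
    obtain ⟨x, hxc, hx⟩ : ∃ x, x < c ∧ 0 < f x := by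
      by_contra! h
      exact hFc0.ne' (hF_zero c fun x hx => (h x hx).antisymm (hf_nonneg x))
    obtain ⟨y, hcy, hy⟩ : ∃ y, c < y ∧ 0 < f y := by
      by_contra! h
      exact hFc1.ne (hF_one c fun x hx => (h x hx).antisymm (hf_nonneg x))
    have hyx : 0 < y - x := by linarith
    have h := hf_sconcave x y ((c - x) / (y - x)) hx hy
      ⟨div_pos (by linarith) hyx, (div_lt_one hyx).2 (by linarith)⟩
    have hθ : 0 < 1 - (c - x) / (y - x) := sub_pos.2 ((div_lt_one hyx).2 (by linarith))
    have hθ' : 0 < (c - x) / (y - x) := div_pos (by linarith) hyx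
    rw [show (1 - (c - x) / (y - x)) * x + (c - x) / (y - x) * y = c by field_simp; ring] at h
    refine (hf_nonneg c).lt_of_ne fun h0 => ?_
    rw [← h0, Real.zero_rpow hs.ne'] at h
    exact absurd h (not_le.2 (by positivity))
  have hconc : ConcaveOn ℝ (Ioo a b) fun t => f t ^ s := by
    refine concaveOn_iff_forall_pos.2 ⟨convex_Ioo a b, fun x hx y hy α β hα hβ hαβ => ?_⟩
    have h := hf_sconcave x y β (hpos x hx) (hpos y hy) ⟨hβ, by linarith⟩
    rwa [show 1 - β = α by linarith] at h
  refine ⟨?_, ?_⟩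
  · simp only [hF]
    exact concaveOn_Ioi_integral_Iic_rpow hs hab hfi hpos hf_supp hconc
  · have hcompl : ∀ x, 1 - F x = ∫ t in Ioi x, f t := fun x => by
      have := integral_add_compl (measurableSet_Iic (a := x)) hfi
      rw [compl_Iic] at this
      rw [hF]
      linarith
    simp only [hcompl]
    exact concaveOn_Iio_integral_Ioi_rpow hs hab hfi hpos hf_supp hconc
end

section
/- Let s ∈ (−1, 0) and s* = s/(1+s) < 0. Let F be a nondegenerate distribution function that is continuous on ℝ and differentiable on J(F) with derivative f = F′ such that for all x ∈ J(F) and all t ∈ ℝ: F(x+t) ≤ F(x) · (1 + s* (f(x)/F(x)) t)_{+}^{1/s*} and F(x+t) ≥ 1 − (1 − F(x)) · (1 − s* (f(x)/(1 − F(x))) t)_{+}^{1/s*}. Then the reverse s*-hazard function h(x) = f(x)/F(x)^{1−s*} is non-increasing on J(F) and the s*-hazard function h̃(x) = f(x)/(1 − F(x))^{1−s*} is non-decreasing on J(F). -/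
/-- A selection of subgradients is monotone. -/
lemma monotoneOn_of_subgradient {S : Set ℝ} {G g : ℝ → ℝ}
    (h : ∀ x ∈ S, ∀ y ∈ S, G x + g x * (y - x) ≤ G y) : MonotoneOn g S := by
  intro x hx y hy hxy
  rcases hxy.eq_or_lt with rfl | hlt
  · exact le_rfl
  · have h1 := h x hx y hy
    have h2 := h y hy x hx
    by_contra! hg
    nlinarith [mul_pos (sub_pos.2 hg) (sub_pos.2 hlt)]

/-- Taking a negative power `a` turns an upper bound with exponent `a⁻¹`, in which `0 ^ a⁻¹ = ∞`,
into a lower bound that is linear in the base. -/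
lemma rpow_mul_le_rpow_of_ofReal_le {a u v c : ℝ} (ha : a < 0) (hu : 0 < u) (hv : 0 < v)
    (h : ENNReal.ofReal v ≤ ENNReal.ofReal u * ENNReal.ofReal c ^ a⁻¹) :
    u ^ a * c ≤ v ^ a := by
  rcases le_or_gt c 0 with hc | hc
  · exact (mul_nonpos_of_nonneg_of_nonpos (Real.rpow_nonneg hu.le a) hc).trans
      (Real.rpow_nonneg hv.le a)
  · have hcp : 0 < c ^ a⁻¹ := Real.rpow_pos_of_pos hc _
    rw [ENNReal.ofReal_rpow_of_pos hc, ← ENNReal.ofReal_mul hu.le,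
      ENNReal.ofReal_le_ofReal_iff (mul_pos hu hcp).le] at h
    have h' := Real.rpow_le_rpow_of_nonpos hv h ha.le
    rwa [Real.mul_rpow hu.le hcp.le, Real.rpow_inv_rpow hc.le ha.ne] at h'

lemma rpow_mul_div_eq_div_rpow_one_sub {u : ℝ} (hu : 0 < u) (a b : ℝ) :
    u ^ a * (b / u) = b / u ^ (1 - a) := by
  have hua : u ^ a ≠ 0 := (Real.rpow_pos_of_pos hu a).ne'
  rw [Real.rpow_sub hu, Real.rpow_one]
  field_simp


open MeasureTheory Set Filter

/-- `J(F) = {x | 0 < F x < 1}`. -/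
def JSet (F : ℝ → ℝ) : Set ℝ := {x : ℝ | 0 < F x ∧ F x < 1}

/-- Let `s ∈ (-1,0)`, `s* = s/(1+s) < 0`. If `F` is a nondegenerate
distribution function, continuous on `ℝ` and differentiable on `J(F)` with derivative
`f = F'` satisfying, for all `x ∈ J(F)` and `t ∈ ℝ`,
`F(x+t) ≤ F(x)·(1 + s*(f(x)/F(x))t)₊^{1/s*}` and
`F(x+t) ≥ 1 - (1-F(x))·(1 - s*(f(x)/(1-F(x)))t)₊^{1/s*}` (stated in `ℝ≥0∞` with the
convention `0^{1/s*} = ∞`, the second in the rearranged form), then the reverse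
`s*`-hazard function `f/F^{1-s*}` is non-increasing on `J(F)` and the `s*`-hazard
function `f/(1-F)^{1-s*}` is non-decreasing on `J(F)`. -/
theorem bounds_imply_hazard_monotone_neg
    (s : ℝ) (hs : s ∈ Set.Ioo (-1 : ℝ) 0)
    (F f : ℝ → ℝ)
    (hF_mono : Monotone F)
    (hF_bot : Filter.Tendsto F Filter.atBot (nhds 0))
    (hF_top : Filter.Tendsto F Filter.atTop (nhds 1))
    (hF_nondeg : (JSet F).Nonempty)
    (hF_cont : Continuous F)
    (hF_deriv : ∀ x ∈ JSet F, HasDerivAt F (f x) x)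
    (hbounds : ∀ x ∈ JSet F, ∀ t : ℝ,
      ENNReal.ofReal (F (x + t)) ≤
        ENNReal.ofReal (F x) *
          ENNReal.ofReal (1 + (s / (1 + s)) * (f x / F x) * t) ^ ((1 + s) / s) ∧
      ENNReal.ofReal (1 - F (x + t)) ≤
        ENNReal.ofReal (1 - F x) *
          ENNReal.ofReal (1 - (s / (1 + s)) * (f x / (1 - F x)) * t) ^ ((1 + s) / s)) :
    AntitoneOn (fun x => f x / F x ^ (1 - s / (1 + s))) (JSet F) ∧
    MonotoneOn (fun x => f x / (1 - F x) ^ (1 - s / (1 + s))) (JSet F) := by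
  set a : ℝ := s / (1 + s)
  have ha : a < 0 := div_neg_of_neg_of_pos hs.2 (by linarith [hs.1])
  have ha_inv : (1 + s) / s = a⁻¹ := (inv_div s (1 + s)).symm
  rw [ha_inv] at hbounds
  constructor
  · have hmono : MonotoneOn (fun x => a * (f x / F x ^ (1 - a))) (JSet F) := by
      refine monotoneOn_of_subgradient (G := fun x => F x ^ a) fun x hx y hy => ?_
      have h := (hbounds x hx (y - x)).1
      rw [add_sub_cancel] at h
      have h' := rpow_mul_le_rpow_of_ofReal_le ha hx.1 hy.1 h
      simp only [← rpow_mul_div_eq_div_rpow_one_sub hx.1]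
      linarith
    intro x hx y hy hxy
    exact (mul_le_mul_left_of_neg ha).1 (hmono hx hy hxy)
  · have hmono : MonotoneOn (fun x => -a * (f x / (1 - F x) ^ (1 - a))) (JSet F) := by
      refine monotoneOn_of_subgradient (G := fun x => (1 - F x) ^ a) fun x hx y hy => ?_
      have h := (hbounds x hx (y - x)).2
      rw [add_sub_cancel] at h
      have h' := rpow_mul_le_rpow_of_ofReal_le ha (sub_pos.2 hx.2) (sub_pos.2 hy.2) h
      simp only [← rpow_mul_div_eq_div_rpow_one_sub (sub_pos.2 hx.2)]
      linarith
    intro x hx y hy hxy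
    exact (mul_le_mul_iff_right₀ (neg_pos.2 ha)).1 (hmono hx hy hxy)
end

section
/- Let s ∈ (−1, 0) and s* = s/(1+s) < 0. Let F be a nondegenerate distribution function that is continuous on ℝ and differentiable on J(F) with derivative f = F′ such that f/F^{1−s*} is non-increasing and f/(1 − F)^{1−s*} is non-decreasing on J(F). Then f is strictly positive and bounded on J(F), f is locally Lipschitz-continuous on J(F), and f is locally absolutely continuous on J(F) with an L¹-derivative f′ (so f(y) − f(x) = ∫_{x}^{y} f′(t) dt for x, y ∈ J(F)) satisfying −(1 − s*) f(x)²/(1 − F(x)) ≤ f′(x) ≤ (1 − s*) f(x)²/F(x) for almost every x ∈ J(F). -/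
open MeasureTheory Set Filter

theorem isOpen_JSet {F : ℝ → ℝ} (hF : Continuous F) : IsOpen (JSet F) :=
  isOpen_Ioo.preimage hF

theorem ordConnected_JSet {F : ℝ → ℝ} (hF : Monotone F) : (JSet F).OrdConnected :=
  ⟨fun _ ha _ hb _ hx => ⟨ha.1.trans_le (hF hx.1), (hF hx.2).trans_lt hb.2⟩⟩

theorem rpow_sub_rpow_le_mul_sub {p u v : ℝ} (hp : 1 ≤ p) (hu : 0 ≤ u) (huv : u ≤ v)
    (hv : 0 < v) (hv1 : v ≤ 1) : v ^ p - u ^ p ≤ p * (v - u) := by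
  have hb := one_add_mul_self_le_rpow_one_add (s := u / v - 1)
    (by linarith [div_nonneg hu hv.le]) hp
  rw [add_sub_cancel, Real.div_rpow hu hv.le, le_div_iff₀ (Real.rpow_pos_of_pos hv p)] at hb
  have hvp : v ^ p ≤ v := by
    simpa using Real.rpow_le_rpow_of_exponent_ge hv hv1 hp
  have hvv : v ^ p * (p * (1 - u / v)) ≤ v * (p * (1 - u / v)) :=
    mul_le_mul_of_nonneg_right hvp
      (mul_nonneg (by linarith) (sub_nonneg.2 ((div_le_one hv).2 huv)))
  have hve : v * (p * (1 - u / v)) = p * (v - u) := by field_simp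
  linarith

theorem sub_le_of_div_rpow_le_div_rpow {p u v c A B M : ℝ} (hp : 1 ≤ p) (hc : 0 < c)
    (hcu : c ≤ u) (huv : u ≤ v) (hv1 : v ≤ 1) (hA : 0 ≤ A) (hAM : A ≤ M)
    (h : B / v ^ p ≤ A / u ^ p) : B - A ≤ M * p / c ^ p * (v - u) := by
  have hu : 0 < u := hc.trans_le hcu
  have hv : 0 < v := hu.trans_le huv
  have hup : 0 < u ^ p := Real.rpow_pos_of_pos hu p
  rw [div_le_iff₀ (Real.rpow_pos_of_pos hv p)] at h
  have hM : 0 ≤ M := hA.trans hAM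
  have hcp : 0 < c ^ p := Real.rpow_pos_of_pos hc p
  have hvu : 0 ≤ v - u := sub_nonneg.2 huv
  calc B - A ≤ A / u ^ p * v ^ p - A := by linarith
    _ = A * (v ^ p - u ^ p) / u ^ p := by field_simp
    _ ≤ A * (p * (v - u)) / u ^ p := by
        gcongr
        exact rpow_sub_rpow_le_mul_sub hp hu.le huv hv hv1
    _ ≤ M * (p * (v - u)) / c ^ p := by gcongr
    _ = M * p / c ^ p * (v - u) := by ring

theorem hasDerivAt_le_of_antitoneOn_div_rpow {S : Set ℝ} {G k : ℝ → ℝ} {p x c d : ℝ}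
    (hS : S ∈ nhds x) (hG : 0 < G x) (hGd : HasDerivAt G c x) (hkd : HasDerivAt k d x)
    (h : AntitoneOn (fun y => k y / G y ^ p) S) : d ≤ p * k x * c / G x := by
  have hGp : 0 < G x ^ p := Real.rpow_pos_of_pos hG p
  have hq := hkd.fun_div (hGd.rpow_const (p := p) (Or.inl hG.ne')) hGp.ne'
  have hle : derivWithin (fun y => k y / G y ^ p) S x ≤ 0 := h.derivWithin_nonpos
  rw [derivWithin_of_mem_nhds hS, hq.deriv, div_nonpos_iff] at hle
  have hnum : d * G x ^ p - k x * (c * p * G x ^ (p - 1)) ≤ 0 := by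
    rcases hle with ⟨_, h2⟩ | ⟨h1, _⟩
    · exact absurd h2 (not_le.2 (by positivity))
    · exact h1
  rw [Real.rpow_sub_one hG.ne'] at hnum
  have hfac : d * G x ^ p - k x * (c * p * (G x ^ p / G x)) =
      G x ^ p * (d - p * k x * c / G x) := by ring
  rw [hfac] at hnum
  exact sub_nonpos.1 (nonpos_of_mul_nonpos_right hnum hGp)

section

variable {F f : ℝ → ℝ} {p : ℝ}

theorem density_nonneg (hF_mono : Monotone F)
    (hF_deriv : ∀ x ∈ JSet F, HasDerivAt F (f x) x) {x : ℝ} (hx : x ∈ JSet F) : 0 ≤ f x := by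
  rw [← (hF_deriv x hx).deriv]
  exact hF_mono.deriv_nonneg

theorem density_pos (hF_mono : Monotone F) (hF_top : Tendsto F atTop (nhds 1))
    (hF_cont : Continuous F) (hF_deriv : ∀ x ∈ JSet F, HasDerivAt F (f x) x)
    (h_anti : AntitoneOn (fun x => f x / F x ^ p) (JSet F))
    (h_mono : MonotoneOn (fun x => f x / (1 - F x) ^ p) (JSet F)) {x : ℝ} (hx : x ∈ JSet F) :
    0 < f x := by
  refine (density_nonneg hF_mono hF_deriv hx).lt_of_ne' fun hfx => ?_
  have hzero : ∀ y ∈ JSet F, f y = 0 := by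
    intro y hy
    refine le_antisymm ?_ (density_nonneg hF_mono hF_deriv hy)
    rcases le_total x y with hxy | hxy
    · have h := h_anti hx hy hxy
      simp only [hfx, zero_div] at h
      rw [div_le_iff₀ (Real.rpow_pos_of_pos hy.1 p)] at h
      simpa using h
    · have h := h_mono hy hx hxy
      simp only [hfx, zero_div] at h
      rw [div_le_iff₀ (Real.rpow_pos_of_pos (sub_pos.2 hy.2) p)] at h
      simpa using h
  obtain ⟨b, hxb, hb⟩ : ∃ b, x ≤ b ∧ (F x + 1) / 2 < F b :=
    ((eventually_ge_atTop x).and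
      (hF_top.eventually (lt_mem_nhds (by linarith [hx.2] : (F x + 1) / 2 < 1)))).exists
  obtain ⟨y, hy, hFy⟩ := intermediate_value_Icc hxb hF_cont.continuousOn
    (show (F x + 1) / 2 ∈ Icc (F x) (F b) from ⟨by linarith [hx.2], hb.le⟩)
  have hyJ : y ∈ JSet F := ⟨by rw [hFy]; linarith [hx.1], by rw [hFy]; linarith [hx.2]⟩
  have h := (ordConnected_JSet hF_mono).convex.image_sub_le_mul_sub_of_deriv_le
    hF_cont.continuousOn
    (fun z hz => (hF_deriv z (interior_subset hz)).differentiableAt.differentiableWithinAt)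
    (C := 0) (fun z hz => by
      rw [(hF_deriv z (interior_subset hz)).deriv, hzero z (interior_subset hz)])
    x hx y hyJ hy.1
  linarith [hx.2]

theorem density_bddAbove (hp : 0 ≤ p) (hF_nondeg : (JSet F).Nonempty) (hF_mono : Monotone F)
    (hF_deriv : ∀ x ∈ JSet F, HasDerivAt F (f x) x)
    (h_anti : AntitoneOn (fun x => f x / F x ^ p) (JSet F))
    (h_mono : MonotoneOn (fun x => f x / (1 - F x) ^ p) (JSet F)) :
    BddAbove (f '' JSet F) := by
  have hle : ∀ {A u : ℝ}, 0 ≤ A → 0 < u → u ≤ 1 → A ≤ A / u ^ p := fun hA hu hu1 =>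
    le_div_self hA (Real.rpow_pos_of_pos hu p) (Real.rpow_le_one hu.le hu1 hp)
  obtain ⟨z, hz⟩ := hF_nondeg
  refine ⟨max (f z / F z ^ p) (f z / (1 - F z) ^ p), ?_⟩
  rintro _ ⟨y, hy, rfl⟩
  have hfy := density_nonneg hF_mono hF_deriv hy
  rcases le_total z y with hzy | hzy
  · exact (hle hfy hy.1 hy.2.le).trans ((h_anti hz hy hzy).trans (le_max_left _ _))
  · exact (hle hfy (sub_pos.2 hy.2) (by linarith [hy.1])).trans
      ((h_mono hy hz hzy).trans (le_max_right _ _))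

theorem density_lipschitzOnWith_Icc (hp : 1 ≤ p) (hF_mono : Monotone F)
    (hF_cont : Continuous F) (hF_deriv : ∀ x ∈ JSet F, HasDerivAt F (f x) x)
    (h_anti : AntitoneOn (fun x => f x / F x ^ p) (JSet F))
    (h_mono : MonotoneOn (fun x => f x / (1 - F x) ^ p) (JSet F))
    {a b : ℝ} (ha : a ∈ JSet F) (hb : b ∈ JSet F) :
    ∃ K : NNReal, LipschitzOnWith K f (Icc a b) := by
  obtain ⟨M, hM⟩ := density_bddAbove (by linarith) ⟨a, ha⟩ hF_mono hF_deriv h_anti h_mono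
  have hfM : ∀ x ∈ JSet F, f x ≤ M := fun x hx => hM (mem_image_of_mem f hx)
  have hM0 : 0 ≤ M := (density_nonneg hF_mono hF_deriv ha).trans (hfM a ha)
  have hsub : Icc a b ⊆ JSet F := (ordConnected_JSet hF_mono).out ha hb
  have hFle : ∀ x ∈ JSet F, ∀ y ∈ JSet F, x ≤ y → F y - F x ≤ M * (y - x) :=
    (ordConnected_JSet hF_mono).convex.image_sub_le_mul_sub_of_deriv_le hF_cont.continuousOn
      (fun z hz => (hF_deriv z (interior_subset hz)).differentiableAt.differentiableWithinAt)
      (fun z hz => by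
        rw [(hF_deriv z (interior_subset hz)).deriv]
        exact hfM z (interior_subset hz))
  have ha0 : 0 < F a ^ p := Real.rpow_pos_of_pos ha.1 p
  have hb1 : 0 < 1 - F b := sub_pos.2 hb.2
  have hb0 : 0 < (1 - F b) ^ p := Real.rpow_pos_of_pos hb1 p
  set L : ℝ := M * p / F a ^ p + M * p / (1 - F b) ^ p
  have hp0 : 0 ≤ p := by linarith
  have hL1 : M * p / F a ^ p ≤ L := le_add_of_nonneg_right (by positivity)
  have hL2 : M * p / (1 - F b) ^ p ≤ L := le_add_of_nonneg_left (by positivity)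
  have hL0 : 0 ≤ L := by positivity
  have key : ∀ x ∈ Icc a b, ∀ y ∈ Icc a b, x ≤ y →
      f y - f x ≤ L * M * (y - x) ∧ f x - f y ≤ L * M * (y - x) := by
    intro x hx y hy hxy
    have hFxy : 0 ≤ F y - F x := sub_nonneg.2 (hF_mono hxy)
    have hLF : L * (F y - F x) ≤ L * M * (y - x) := by
      rw [mul_assoc]
      exact mul_le_mul_of_nonneg_left (hFle x (hsub hx) y (hsub hy) hxy) hL0
    constructor
    · have h := sub_le_of_div_rpow_le_div_rpow hp ha.1 (hF_mono hx.1) (hF_mono hxy)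
        (hsub hy).2.le (density_nonneg hF_mono hF_deriv (hsub hx)) (hfM x (hsub hx))
        (h_anti (hsub hx) (hsub hy) hxy)
      exact h.trans ((mul_le_mul_of_nonneg_right hL1 hFxy).trans hLF)
    · have h := sub_le_of_div_rpow_le_div_rpow hp hb1 (sub_le_sub_left (hF_mono hy.2) 1)
        (sub_le_sub_left (hF_mono hxy) 1) (by linarith [(hsub hx).1])
        (density_nonneg hF_mono hF_deriv (hsub hy)) (hfM y (hsub hy))
        (h_mono (hsub hx) (hsub hy) hxy)
      rw [sub_sub_sub_cancel_left] at h
      exact h.trans ((mul_le_mul_of_nonneg_right hL2 hFxy).trans hLF)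
  refine ⟨(L * M).toNNReal, LipschitzOnWith.of_le_add_mul' _ fun x hx y hy => ?_⟩
  rw [Real.dist_eq]
  rcases le_total x y with hxy | hxy
  · rw [abs_sub_comm, abs_of_nonneg (sub_nonneg.2 hxy)]
    linarith [(key x hx y hy hxy).2]
  · rw [abs_of_nonneg (sub_nonneg.2 hxy)]
    linarith [(key y hy x hx hxy).1]

theorem density_ae_differentiableAt (hF_cont : Continuous F)
    (hF_deriv : ∀ x ∈ JSet F, HasDerivAt F (f x) x)
    (h_anti : AntitoneOn (fun x => f x / F x ^ p) (JSet F)) :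
    ∀ᵐ x ∂(volume : Measure ℝ), x ∈ JSet F → DifferentiableAt ℝ f x := by
  filter_upwards [h_anti.neg.ae_differentiableWithinAt_of_mem] with x hd hx
  have hJ : JSet F ∈ nhds x := (isOpen_JSet hF_cont).mem_nhds hx
  have hq : DifferentiableAt ℝ (fun y => f y / F y ^ p) x := by
    simpa using ((hd hx).differentiableAt hJ).neg
  have hFp : DifferentiableAt ℝ (fun y => F y ^ p) x :=
    (hF_deriv x hx).differentiableAt.rpow_const (Or.inl hx.1.ne')
  refine (hq.fun_mul hFp).congr_of_eventuallyEq ?_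
  filter_upwards [hJ] with y hy
  exact (div_mul_cancel₀ _ (Real.rpow_pos_of_pos hy.1 p).ne').symm

end

/-- Let `s ∈ (-1,0)`, `s* = s/(1+s) < 0`. If `F` is a nondegenerate
distribution function, continuous on `ℝ` and differentiable on `J(F)` with derivative
`f = F'`, such that `f/F^{1-s*}` is non-increasing and `f/(1-F)^{1-s*}` is non-decreasing
on `J(F)`, then `f` is strictly positive and bounded on `J(F)`, locally
Lipschitz-continuous on `J(F)`, and locally absolutely continuous on `J(F)` with an
`L¹`-derivative `f'` (so `f(y) - f(x) = ∫_x^y f'` for `x, y ∈ J(F)`) satisfying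
`-(1-s*) f² / (1-F) ≤ f' ≤ (1-s*) f² / F` almost everywhere on `J(F)`. -/
theorem hazard_monotone_implies_lipschitz_neg
    (s : ℝ) (hs : s ∈ Set.Ioo (-1 : ℝ) 0)
    (F f : ℝ → ℝ)
    (hF_mono : Monotone F)
    (hF_bot : Filter.Tendsto F Filter.atBot (nhds 0))
    (hF_top : Filter.Tendsto F Filter.atTop (nhds 1))
    (hF_nondeg : (JSet F).Nonempty)
    (hF_cont : Continuous F)
    (hF_deriv : ∀ x ∈ JSet F, HasDerivAt F (f x) x)
    (h_anti : AntitoneOn (fun x => f x / F x ^ (1 - s / (1 + s))) (JSet F))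
    (h_mono : MonotoneOn (fun x => f x / (1 - F x) ^ (1 - s / (1 + s))) (JSet F)) :
    (∀ x ∈ JSet F, 0 < f x) ∧
    BddAbove (f '' JSet F) ∧
    (∀ x ∈ JSet F, ∃ K : NNReal, ∃ U ∈ nhdsWithin x (JSet F), LipschitzOnWith K f U) ∧
    ∃ f' : ℝ → ℝ,
      (∀ x ∈ JSet F, ∀ y ∈ JSet F, f y - f x = ∫ t in x..y, f' t) ∧
      (∀ᵐ x ∂(volume : Measure ℝ), x ∈ JSet F →
        -((1 - s / (1 + s)) * f x ^ 2 / (1 - F x)) ≤ f' x ∧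
        f' x ≤ (1 - s / (1 + s)) * f x ^ 2 / F x) := by
  have hp : 1 ≤ 1 - s / (1 + s) := by
    have := div_nonpos_of_nonpos_of_nonneg hs.2.le (by linarith [hs.1] : 0 ≤ 1 + s)
    linarith
  generalize 1 - s / (1 + s) = p at *
  have hlip {a b : ℝ} (ha : a ∈ JSet F) (hb : b ∈ JSet F) :
      ∃ K : NNReal, LipschitzOnWith K f (Icc a b) :=
    density_lipschitzOnWith_Icc hp hF_mono hF_cont hF_deriv h_anti h_mono ha hb
  refine ⟨fun x hx => density_pos hF_mono hF_top hF_cont hF_deriv h_anti h_mono hx,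
    density_bddAbove (by linarith) hF_nondeg hF_mono hF_deriv h_anti h_mono,
    fun x hx => ?_, deriv f, fun x hx y hy => ?_, ?_⟩
  · obtain ⟨a, b, hxab, hnhds, hsub⟩ :=
      exists_Icc_mem_subset_of_mem_nhds ((isOpen_JSet hF_cont).mem_nhds hx)
    have hab : a ≤ b := hxab.1.trans hxab.2
    obtain ⟨K, hK⟩ := hlip (hsub (left_mem_Icc.2 hab)) (hsub (right_mem_Icc.2 hab))
    exact ⟨K, Icc a b, mem_nhdsWithin_of_mem_nhds hnhds, hK⟩
  · have hmin : min x y ∈ JSet F := by rcases min_choice x y with h | h <;> rwa [h]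
    have hmax : max x y ∈ JSet F := by rcases max_choice x y with h | h <;> rwa [h]
    obtain ⟨K, hK⟩ := hlip hmin hmax
    exact (hK.absolutelyContinuousOnInterval (a := x) (b := y)).integral_deriv_eq_sub.symm
  · filter_upwards [density_ae_differentiableAt hF_cont hF_deriv h_anti] with x hd hx
    have hJ : JSet F ∈ nhds x := (isOpen_JSet hF_cont).mem_nhds hx
    have hupper := hasDerivAt_le_of_antitoneOn_div_rpow hJ hx.1 (hF_deriv x hx)
      (hd hx).hasDerivAt h_anti
    have h_anti' : AntitoneOn (fun y => -f y / (1 - F y) ^ p) (JSet F) := by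
      simpa only [neg_div] using h_mono.neg
    have hlower := hasDerivAt_le_of_antitoneOn_div_rpow (G := fun y => 1 - F y) hJ
      (sub_pos.2 hx.2) ((hF_deriv x hx).const_sub 1) (hd hx).hasDerivAt.fun_neg h_anti'
    constructor
    · rw [neg_le]
      convert hlower using 2
      ring
    · convert hupper using 2
      ring
end

section
/- Let s ∈ (−1, 0) and s* = s/(1+s) < 0. Let F be a nondegenerate distribution function that is continuous on ℝ and differentiable on J(F) with derivative f = F′ such that f/F^{1−s*} is non-increasing and f/(1 − F)^{1−s*} is non-decreasing on J(F). Then F is bi-s*-concave: x ↦ F(x)^{s*} and x ↦ (1 − F(x))^{s*} are convex on J(F). -/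
open MeasureTheory Set Filter

theorem convexOn_rpow_of_monotoneOn_deriv {D : Set ℝ} (hD : Convex ℝ D) {G g : ℝ → ℝ} {p : ℝ}
    (hpos : ∀ x ∈ D, 0 < G x) (hderiv : ∀ x ∈ D, HasDerivAt G (g x) x)
    (hmono : MonotoneOn (fun x => p * (g x / G x ^ (1 - p))) D) :
    ConvexOn ℝ D (fun x => G x ^ p) := by
  have hd : ∀ x ∈ D, HasDerivAt (fun x => G x ^ p) (p * (g x / G x ^ (1 - p))) x := by
    intro x hx
    convert (hderiv x hx).rpow_const (p := p) (Or.inl (hpos x hx).ne') using 1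
    rw [← neg_sub p 1, Real.rpow_neg (hpos x hx).le, div_inv_eq_mul]
    ring
  refine MonotoneOn.convexOn_of_deriv hD
    (fun x hx => (hd x hx).continuousAt.continuousWithinAt)
    (fun x hx => (hd x (interior_subset hx)).differentiableAt.differentiableWithinAt) ?_
  exact (hmono.mono interior_subset).congr
    fun x hx => (hd x (interior_subset hx)).deriv.symm

theorem JSet_convex {F : ℝ → ℝ} (hF : Monotone F) : Convex ℝ (JSet F) :=
  (ordConnected_Ioo.preimage_mono hF).convex

/-- Let `s ∈ (-1,0)`, `s* = s/(1+s) < 0`. If `F` is a nondegenerate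
distribution function, continuous on `ℝ` and differentiable on `J(F)` with derivative
`f = F'` such that `f/F^{1-s*}` is non-increasing and `f/(1-F)^{1-s*}` is non-decreasing
on `J(F)`, then `F` is bi-`s*`-concave: `x ↦ F(x)^{s*}` and `x ↦ (1-F(x))^{s*}` are
convex on `J(F)`. -/
theorem hazard_monotone_implies_bi_sStar_concave_neg
    (s : ℝ) (hs : s ∈ Set.Ioo (-1 : ℝ) 0)
    (F f : ℝ → ℝ)
    (hF_mono : Monotone F)
    (hF_bot : Filter.Tendsto F Filter.atBot (nhds 0))
    (hF_top : Filter.Tendsto F Filter.atTop (nhds 1))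
    (hF_nondeg : (JSet F).Nonempty)
    (hF_cont : Continuous F)
    (hF_deriv : ∀ x ∈ JSet F, HasDerivAt F (f x) x)
    (h_anti : AntitoneOn (fun x => f x / F x ^ (1 - s / (1 + s))) (JSet F))
    (h_mono : MonotoneOn (fun x => f x / (1 - F x) ^ (1 - s / (1 + s))) (JSet F)) :
    ConvexOn ℝ (JSet F) (fun x => F x ^ (s / (1 + s))) ∧
    ConvexOn ℝ (JSet F) (fun x => (1 - F x) ^ (s / (1 + s))) := by
  have hs' : s / (1 + s) < 0 := div_neg_of_neg_of_pos hs.2 (by linarith [hs.1])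
  constructor
  · exact convexOn_rpow_of_monotoneOn_deriv (JSet_convex hF_mono) (fun x hx => hx.1) hF_deriv
      fun x hx y hy hxy => mul_le_mul_of_nonpos_left (h_anti hx hy hxy) hs'.le
  · refine convexOn_rpow_of_monotoneOn_deriv (g := fun x => -f x) (JSet_convex hF_mono)
      (fun x hx => sub_pos.2 hx.2) (fun x hx => (hF_deriv x hx).const_sub 1) ?_
    intro x hx y hy hxy
    simpa only [neg_div, mul_neg, neg_mul] using
      mul_le_mul_of_nonneg_left (h_mono hx hy hxy) (neg_nonneg.2 hs'.le)
end

section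
/- Let s ∈ (0, ∞) and s* = s/(1+s) ∈ (0,1). Let F be a nondegenerate distribution function that is continuous on ℝ and differentiable on J(F) = (a,b) with derivative f = F′ such that for all x ∈ J(F): F(x+t) ≤ F(x) · (1 + s* (f(x)/F(x)) t)_{+}^{1/s*} for all t ∈ (a − x, ∞), and F(x+t) ≥ 1 − (1 − F(x)) · (1 − s* (f(x)/(1 − F(x))) t)_{+}^{1/s*} for all t ∈ (−∞, b − x). Then f/F^{1−s*} is non-increasing on J(F) and f/(1 − F)^{1−s*} is non-decreasing on J(F). -/
open MeasureTheory Set Filter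

/-- A power-type upper bound `v ≤ u (1 + p (c / u) t)₊ ^ (1 / p)` between positive numbers is a
tangent-line inequality for the `p`-th powers of `u` and `v`. -/
theorem rpow_sub_rpow_le_of_le_mul_max_rpow {p q u v c t : ℝ} (hpq : q * p = 1)
    (hu : 0 < u) (hv : 0 < v) (hp : 0 < p)
    (h : v ≤ u * max (1 + p * (c / u) * t) 0 ^ q) :
    v ^ p - u ^ p ≤ p * (c / u ^ (1 - p)) * t := by
  have hq : q ≠ 0 := left_ne_zero_of_mul_eq_one hpq
  have hpos : 0 < 1 + p * (c / u) * t := by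
    by_contra! hle
    rw [max_eq_right hle, Real.zero_rpow hq, mul_zero] at h
    exact absurd h hv.not_ge
  rw [max_eq_left hpos.le] at h
  have hpow := Real.rpow_le_rpow hv.le h hp.le
  rw [Real.mul_rpow hu.le (Real.rpow_nonneg hpos.le q), ← Real.rpow_mul hpos.le, hpq,
    Real.rpow_one] at hpow
  have hc : c / u ^ (1 - p) = c / u * u ^ p := by
    rw [Real.rpow_sub hu, Real.rpow_one]
    field_simp
  rw [hc]
  linarith

/-- Let `s ∈ (0,∞)`, `s* = s/(1+s) ∈ (0,1)`. If `F` is a nondegenerate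
distribution function, continuous on `ℝ` and differentiable on `J(F) = (a,b)` with
derivative `f = F'` satisfying, for all `x ∈ J(F)`,
`F(x+t) ≤ F(x)·(1 + s*(f(x)/F(x))t)₊^{1/s*}` for all `t ∈ (a-x,∞)` and
`F(x+t) ≥ 1 - (1-F(x))·(1 - s*(f(x)/(1-F(x)))t)₊^{1/s*}` for all `t ∈ (-∞, b-x)`,
then `f/F^{1-s*}` is non-increasing on `J(F)` and `f/(1-F)^{1-s*}` is non-decreasing
on `J(F)`. -/
theorem bounds_imply_hazard_monotone_pos
    (s : ℝ) (hs : 0 < s)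
    (F f : ℝ → ℝ) (a b : ℝ)
    (hF_mono : Monotone F)
    (hF_bot : Filter.Tendsto F Filter.atBot (nhds 0))
    (hF_top : Filter.Tendsto F Filter.atTop (nhds 1))
    (hF_nondeg : (JSet F).Nonempty)
    (hJ : JSet F = Set.Ioo a b)
    (hF_cont : Continuous F)
    (hF_deriv : ∀ x ∈ JSet F, HasDerivAt F (f x) x)
    (hbounds : ∀ x ∈ JSet F,
      (∀ t : ℝ, a - x < t →
        F (x + t) ≤ F x * max (1 + (s / (1 + s)) * (f x / F x) * t) 0 ^ ((1 + s) / s)) ∧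
      (∀ t : ℝ, t < b - x →
        1 - (1 - F x) * max (1 - (s / (1 + s)) * (f x / (1 - F x)) * t) 0 ^ ((1 + s) / s)
          ≤ F (x + t))) :
    AntitoneOn (fun x => f x / F x ^ (1 - s / (1 + s))) (JSet F) ∧
    MonotoneOn (fun x => f x / (1 - F x) ^ (1 - s / (1 + s))) (JSet F) := by
  have hp : 0 < s / (1 + s) := by positivity
  have hpq : (1 + s) / s * (s / (1 + s)) = 1 := by field_simp
  have lower : ∀ x ∈ JSet F, ∀ y ∈ JSet F, F y ^ (s / (1 + s)) - F x ^ (s / (1 + s)) ≤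
      s / (1 + s) * (f x / F x ^ (1 - s / (1 + s))) * (y - x) := by
    intro x hx y hy
    have hay : a < y := (hJ ▸ hy : y ∈ Set.Ioo a b).1
    have h := (hbounds x hx).1 (y - x) (by linarith)
    rw [add_sub_cancel] at h
    exact rpow_sub_rpow_le_of_le_mul_max_rpow hpq hx.1 hy.1 hp h
  have upper : ∀ x ∈ JSet F, ∀ y ∈ JSet F,
      (1 - F y) ^ (s / (1 + s)) - (1 - F x) ^ (s / (1 + s)) ≤
      s / (1 + s) * (f x / (1 - F x) ^ (1 - s / (1 + s))) * (x - y) := by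
    intro x hx y hy
    have hyb : y < b := (hJ ▸ hy : y ∈ Set.Ioo a b).2
    have h := (hbounds x hx).2 (y - x) (by linarith)
    rw [add_sub_cancel] at h
    refine rpow_sub_rpow_le_of_le_mul_max_rpow hpq (sub_pos.2 hx.2) (sub_pos.2 hy.2) hp ?_
    rw [show 1 + s / (1 + s) * (f x / (1 - F x)) * (x - y) =
      1 - s / (1 + s) * (f x / (1 - F x)) * (y - x) by ring]
    linarith
  constructor
  · intro x hx y hy hxy
    rcases hxy.eq_or_lt with rfl | hlt
    · exact le_rfl
    · refine le_of_mul_le_mul_left ?_ hp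
      refine le_of_mul_le_mul_right ?_ (sub_pos.2 hlt)
      linarith [lower x hx y hy, lower y hy x hx]
  · intro x hx y hy hxy
    rcases hxy.eq_or_lt with rfl | hlt
    · exact le_rfl
    · refine le_of_mul_le_mul_left ?_ hp
      refine le_of_mul_le_mul_right ?_ (sub_pos.2 hlt)
      linarith [upper x hx y hy, upper y hy x hx]
end

section
/- Let s ∈ (0, ∞) and s* = s/(1+s) ∈ (0,1). Let F be a nondegenerate distribution function that is continuous on ℝ and differentiable on J(F) with derivative f = F′ such that f/F^{1−s*} is non-increasing and f/(1 − F)^{1−s*} is non-decreasing on J(F). Then f is strictly positive and bounded on J(F), f is locally Lipschitz-continuous on J(F), and f is locally absolutely continuous on J(F) with an L¹-derivative f′ (f(y) − f(x) = ∫_{x}^{y} f′(t) dt for x, y ∈ J(F)) satisfying −(1 − s*) f(x)²/(1 − F(x)) ≤ f′(x) ≤ (1 − s*) f(x)²/F(x) for almost every x ∈ J(F). -/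
open MeasureTheory Set Filter

/-- Concavity of `t ↦ t ^ p` bounds the increment of `a ↦ b` when `a / u ^ p` dominates
`b / v ^ p`. -/
theorem sub_le_of_div_rpow_le_div_rpow_s12 {p a b u v : ℝ} (hp₀ : 0 ≤ p) (hp₁ : p ≤ 1)
    (ha : 0 ≤ a) (hu : 0 < u) (hv : 0 < v) (h : b / v ^ p ≤ a / u ^ p) :
    b - a ≤ p * a / u * (v - u) := by
  have hvp : 0 < v ^ p := Real.rpow_pos_of_pos hv p
  have hb : b ≤ a * (v / u) ^ p := by
    rw [Real.div_rpow hv.le hu.le]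
    calc b ≤ a / u ^ p * v ^ p := (div_le_iff₀ hvp).1 h
      _ = a * (v ^ p / u ^ p) := by ring
  have hbern : (v / u) ^ p ≤ 1 + p * (v / u - 1) := by
    have hvu : 0 < v / u := div_pos hv hu
    simpa using rpow_one_add_le_one_add_mul_self (s := v / u - 1) (by linarith) hp₀ hp₁
  calc b - a ≤ a * (1 + p * (v / u - 1)) - a := by
        linarith [mul_le_mul_of_nonneg_left hbern ha]
    _ = p * a / u * (v - u) := by field_simp; ring

theorem HasDerivAt.nonpos_of_eventually_le_right {g : ℝ → ℝ} {d x : ℝ} (hg : HasDerivAt g d x)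
    (h : ∀ᶠ y in nhdsWithin x (Ioi x), g y ≤ g x) : d ≤ 0 := by
  have hs := (hasDerivWithinAt_iff_tendsto_slope' self_notMem_Ioi).1
    (hg.hasDerivWithinAt (s := Ioi x))
  refine le_of_tendsto hs ?_
  filter_upwards [h, self_mem_nhdsWithin] with y hy hxy
  rw [slope_def_field]
  exact div_nonpos_of_nonpos_of_nonneg (by linarith) (sub_nonneg.2 (le_of_lt hxy))

theorem HasDerivAt.nonneg_of_eventually_le_left {g : ℝ → ℝ} {d x : ℝ} (hg : HasDerivAt g d x)
    (h : ∀ᶠ y in nhdsWithin x (Iio x), g y ≤ g x) : 0 ≤ d := by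
  have hs := (hasDerivWithinAt_iff_tendsto_slope' self_notMem_Iio).1
    (hg.hasDerivWithinAt (s := Iio x))
  refine ge_of_tendsto hs ?_
  filter_upwards [h, self_mem_nhdsWithin] with y hy hxy
  rw [slope_def_field]
  exact div_nonneg_of_nonpos (by linarith) (sub_nonpos.2 (le_of_lt hxy))

theorem exists_eq_of_tendsto_zero_one {F : ℝ → ℝ} (hF_bot : Tendsto F atBot (nhds 0))
    (hF_top : Tendsto F atTop (nhds 1)) (hF_cont : Continuous F) {c : ℝ} (hc₀ : 0 < c)
    (hc₁ : c < 1) : ∃ x, F x = c := by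
  obtain ⟨a, ha⟩ := (hF_bot.eventually_lt_const hc₀).exists
  obtain ⟨b, hb⟩ := (hF_top.eventually_const_lt hc₁).exists
  exact mem_range_of_exists_le_of_exists_ge hF_cont ⟨a, ha.le⟩ ⟨b, hb.le⟩

section PowerHazard

variable {F f : ℝ → ℝ} {p : ℝ}

theorem nonneg_of_hasDerivAt_of_monotone (hF_mono : Monotone F) {x : ℝ}
    (hF_deriv : HasDerivAt F (f x) x) : 0 ≤ f x :=
  hF_deriv.nonneg_of_eventually_le_left <| by
    filter_upwards [self_mem_nhdsWithin] with y hy using hF_mono (le_of_lt hy)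

theorem pos_of_hazard_monotone (hF_mono : Monotone F)
    (hF_bot : Tendsto F atBot (nhds 0)) (hF_top : Tendsto F atTop (nhds 1))
    (hF_cont : Continuous F) (hF_deriv : ∀ x ∈ JSet F, HasDerivAt F (f x) x)
    (h_anti : AntitoneOn (fun x => f x / F x ^ p) (JSet F))
    (h_mono : MonotoneOn (fun x => f x / (1 - F x) ^ p) (JSet F)) :
    ∀ x ∈ JSet F, 0 < f x := by
  intro x hx
  have hnonneg : ∀ y ∈ JSet F, 0 ≤ f y := fun y hy =>
    nonneg_of_hasDerivAt_of_monotone hF_mono (hF_deriv y hy)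
  refine lt_of_le_of_ne (hnonneg x hx) fun h0 => ?_
  have hzero : ∀ y ∈ JSet F, f y = 0 := by
    intro y hy
    refine le_antisymm ?_ (hnonneg y hy)
    rcases le_total x y with hxy | hyx
    · have h := h_anti hx hy hxy
      simp only [← h0, zero_div] at h
      simpa using (div_le_iff₀ (Real.rpow_pos_of_pos hy.1 p)).1 h
    · have h := h_mono hy hx hyx
      simp only [← h0, zero_div] at h
      simpa using (div_le_iff₀ (Real.rpow_pos_of_pos (sub_pos.2 hy.2) p)).1 h
  obtain ⟨a, ha⟩ := exists_eq_of_tendsto_zero_one hF_bot hF_top hF_cont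
    (c := 1 / 3) (by norm_num) (by norm_num)
  obtain ⟨b, hb⟩ := exists_eq_of_tendsto_zero_one hF_bot hF_top hF_cont
    (c := 2 / 3) (by norm_num) (by norm_num)
  have haJ : a ∈ JSet F := by constructor <;> rw [ha] <;> norm_num
  have hbJ : b ∈ JSet F := by constructor <;> rw [hb] <;> norm_num
  have h := (ordConnected_JSet hF_mono).convex.norm_image_sub_le_of_norm_hasDerivWithin_le
    (C := 0) (fun y hy => (hF_deriv y hy).hasDerivWithinAt)
    (fun y hy => by simp [hzero y hy]) haJ hbJ
  rw [ha, hb] at h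
  norm_num at h

theorem bddAbove_of_hazard_monotone (hp : 0 ≤ p) (hF_mono : Monotone F)
    (hF_nondeg : (JSet F).Nonempty) (hF_deriv : ∀ x ∈ JSet F, HasDerivAt F (f x) x)
    (h_anti : AntitoneOn (fun x => f x / F x ^ p) (JSet F))
    (h_mono : MonotoneOn (fun x => f x / (1 - F x) ^ p) (JSet F)) :
    BddAbove (f '' JSet F) := by
  obtain ⟨x, hx⟩ := hF_nondeg
  have hfx := nonneg_of_hasDerivAt_of_monotone hF_mono (hF_deriv x hx)
  have hG : 0 ≤ f x / F x ^ p := div_nonneg hfx (Real.rpow_nonneg hx.1.le p)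
  have hH : 0 ≤ f x / (1 - F x) ^ p :=
    div_nonneg hfx (Real.rpow_nonneg (sub_nonneg.2 hx.2.le) p)
  refine ⟨f x / F x ^ p + f x / (1 - F x) ^ p, ?_⟩
  rintro _ ⟨y, hy, rfl⟩
  have hy' : 0 < 1 - F y := sub_pos.2 hy.2
  rcases le_total x y with hxy | hyx
  · have h := (div_le_iff₀ (Real.rpow_pos_of_pos hy.1 p)).1 (h_anti hx hy hxy)
    have := mul_le_of_le_one_right hG (Real.rpow_le_one hy.1.le hy.2.le hp)
    linarith
  · have h := (div_le_iff₀ (Real.rpow_pos_of_pos hy' p)).1 (h_mono hy hx hyx)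
    have := mul_le_of_le_one_right hH (Real.rpow_le_one hy'.le (by linarith [hy.1]) hp)
    linarith

theorem sub_le_of_antitoneOn_div_rpow (hp₀ : 0 ≤ p) (hp₁ : p ≤ 1)
    (hf : ∀ x ∈ JSet F, 0 ≤ f x) (h_anti : AntitoneOn (fun x => f x / F x ^ p) (JSet F))
    {x y : ℝ} (hx : x ∈ JSet F) (hy : y ∈ JSet F) (hxy : x ≤ y) :
    f y - f x ≤ p * f x / F x * (F y - F x) :=
  sub_le_of_div_rpow_le_div_rpow_s12 hp₀ hp₁ (hf x hx) hx.1 hy.1 (h_anti hx hy hxy)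

theorem sub_le_of_monotoneOn_div_rpow (hp₀ : 0 ≤ p) (hp₁ : p ≤ 1)
    (hf : ∀ x ∈ JSet F, 0 ≤ f x) (h_mono : MonotoneOn (fun x => f x / (1 - F x) ^ p) (JSet F))
    {x y : ℝ} (hx : x ∈ JSet F) (hy : y ∈ JSet F) (hxy : x ≤ y) :
    f x - f y ≤ p * f y / (1 - F y) * (F y - F x) := by
  have h := sub_le_of_div_rpow_le_div_rpow_s12 hp₀ hp₁ (hf y hy) (sub_pos.2 hy.2) (sub_pos.2 hx.2)
    (h_mono hx hy hxy)
  rwa [sub_sub_sub_cancel_left] at h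

theorem exists_lipschitzOnWith_Icc_of_hazard_monotone (hp₀ : 0 ≤ p) (hp₁ : p ≤ 1)
    (hF_mono : Monotone F) (hF_deriv : ∀ x ∈ JSet F, HasDerivAt F (f x) x)
    (h_anti : AntitoneOn (fun x => f x / F x ^ p) (JSet F))
    (h_mono : MonotoneOn (fun x => f x / (1 - F x) ^ p) (JSet F))
    {a b : ℝ} (ha : a ∈ JSet F) (hb : b ∈ JSet F) :
    ∃ K : NNReal, LipschitzOnWith K f (Icc a b) := by
  have hf : ∀ x ∈ JSet F, 0 ≤ f x := fun y hy =>
    nonneg_of_hasDerivAt_of_monotone hF_mono (hF_deriv y hy)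
  obtain ⟨M, hM⟩ := bddAbove_of_hazard_monotone hp₀ hF_mono ⟨a, ha⟩ hF_deriv h_anti h_mono
  have hfM : ∀ x ∈ JSet F, f x ≤ M := fun x hx => hM (mem_image_of_mem f hx)
  have hM₀ : 0 ≤ M := (hf a ha).trans (hfM a ha)
  have hsub : Icc a b ⊆ JSet F := (ordConnected_JSet hF_mono).out ha hb
  have hb' : 0 < 1 - F b := sub_pos.2 hb.2
  have hF_lip : ∀ x ∈ JSet F, ∀ y ∈ JSet F, x ≤ y → F y - F x ≤ M * (y - x) := by
    intro x hx y hy hxy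
    have h := (ordConnected_JSet hF_mono).convex.norm_image_sub_le_of_norm_hasDerivWithin_le
      (C := M) (fun z hz => (hF_deriv z hz).hasDerivWithinAt)
      (fun z hz => by rw [Real.norm_of_nonneg (hf z hz)]; exact hfM z hz) hx hy
    rw [Real.norm_of_nonneg (sub_nonneg.2 hxy)] at h
    exact (le_abs_self _).trans h
  set A := p * M / F a
  set B := p * M / (1 - F b)
  have hA : 0 ≤ A := div_nonneg (mul_nonneg hp₀ hM₀) ha.1.le
  have hB : 0 ≤ B := div_nonneg (mul_nonneg hp₀ hM₀) hb'.le
  have hK : 0 ≤ (A + B) * M := mul_nonneg (add_nonneg hA hB) hM₀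
  have key : ∀ x ∈ Icc a b, ∀ y ∈ Icc a b, x ≤ y →
      f y - f x ≤ (A + B) * M * (y - x) ∧ f x - f y ≤ (A + B) * M * (y - x) := by
    intro x hx y hy hxy
    have hxJ := hsub hx
    have hyJ := hsub hy
    have hF₀ : 0 ≤ F y - F x := sub_nonneg.2 (hF_mono hxy)
    have hbound : ∀ c ≤ A + B, c * (F y - F x) ≤ (A + B) * M * (y - x) := fun c hc =>
      calc c * (F y - F x) ≤ (A + B) * (F y - F x) := mul_le_mul_of_nonneg_right hc hF₀
        _ ≤ (A + B) * (M * (y - x)) :=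
          mul_le_mul_of_nonneg_left (hF_lip x hxJ y hyJ hxy) (add_nonneg hA hB)
        _ = (A + B) * M * (y - x) := by ring
    constructor
    · refine (sub_le_of_antitoneOn_div_rpow hp₀ hp₁ hf h_anti hxJ hyJ hxy).trans (hbound _ ?_)
      have : p * f x / F x ≤ A := div_le_div₀ (mul_nonneg hp₀ hM₀)
        (mul_le_mul_of_nonneg_left (hfM x hxJ) hp₀) ha.1 (hF_mono hx.1)
      linarith
    · refine (sub_le_of_monotoneOn_div_rpow hp₀ hp₁ hf h_mono hxJ hyJ hxy).trans (hbound _ ?_)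
      have : p * f y / (1 - F y) ≤ B := div_le_div₀ (mul_nonneg hp₀ hM₀)
        (mul_le_mul_of_nonneg_left (hfM y hyJ) hp₀) hb' (sub_le_sub_left (hF_mono hy.2) 1)
      linarith
  refine ⟨.mk ((A + B) * M) hK, LipschitzOnWith.of_le_add_mul _ fun x hx y hy => ?_⟩
  rw [NNReal.coe_mk, Real.dist_eq]
  rcases le_total x y with hxy | hyx
  · rw [abs_sub_comm, abs_of_nonneg (sub_nonneg.2 hxy)]
    linarith [(key x hx y hy hxy).2]
  · rw [abs_of_nonneg (sub_nonneg.2 hyx)]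
    linarith [(key y hy x hx hyx).1]

theorem deriv_bounds_of_hazard_monotone (hp₀ : 0 ≤ p) (hp₁ : p ≤ 1) (hF_cont : Continuous F)
    (hf : ∀ x ∈ JSet F, 0 ≤ f x) (hF_deriv : ∀ x ∈ JSet F, HasDerivAt F (f x) x)
    (h_anti : AntitoneOn (fun x => f x / F x ^ p) (JSet F))
    (h_mono : MonotoneOn (fun x => f x / (1 - F x) ^ p) (JSet F))
    {x d : ℝ} (hx : x ∈ JSet F) (hd : HasDerivAt f d x) :
    -(p * f x ^ 2 / (1 - F x)) ≤ d ∧ d ≤ p * f x ^ 2 / F x := by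
  have hJ : JSet F ∈ nhds x := (isOpen_JSet hF_cont).mem_nhds hx
  constructor
  · have hg := hd.add ((hF_deriv x hx).const_mul (p * f x / (1 - F x)))
    have h := hg.nonneg_of_eventually_le_left <| by
      filter_upwards [mem_nhdsWithin_of_mem_nhds hJ, self_mem_nhdsWithin] with y hy hyx
      have := sub_le_of_monotoneOn_div_rpow hp₀ hp₁ hf h_mono hy hx (le_of_lt hyx)
      simp only [Pi.add_apply]
      linarith
    have e : p * f x / (1 - F x) * f x = p * f x ^ 2 / (1 - F x) := by ring
    linarith
  · have hg := hd.sub ((hF_deriv x hx).const_mul (p * f x / F x))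
    have h := hg.nonpos_of_eventually_le_right <| by
      filter_upwards [mem_nhdsWithin_of_mem_nhds hJ, self_mem_nhdsWithin] with y hy hxy
      have := sub_le_of_antitoneOn_div_rpow hp₀ hp₁ hf h_anti hx hy (le_of_lt hxy)
      simp only [Pi.sub_apply]
      linarith
    have e : p * f x / F x * f x = p * f x ^ 2 / F x := by ring
    linarith

end PowerHazard

/-- Let `s ∈ (0,∞)`, `s* = s/(1+s) ∈ (0,1)`. If `F` is a nondegenerate
distribution function, continuous on `ℝ` and differentiable on `J(F)` with derivative
`f = F'`, such that `f/F^{1-s*}` is non-increasing and `f/(1-F)^{1-s*}` is non-decreasing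
on `J(F)`, then `f` is strictly positive and bounded on `J(F)`, locally
Lipschitz-continuous on `J(F)`, and locally absolutely continuous on `J(F)` with an
`L¹`-derivative `f'` (so `f(y) - f(x) = ∫_x^y f'` for `x, y ∈ J(F)`) satisfying
`-(1-s*) f² / (1-F) ≤ f' ≤ (1-s*) f² / F` almost everywhere on `J(F)`. -/
theorem hazard_monotone_implies_lipschitz_pos
    (s : ℝ) (hs : 0 < s)
    (F f : ℝ → ℝ)
    (hF_mono : Monotone F)
    (hF_bot : Filter.Tendsto F Filter.atBot (nhds 0))
    (hF_top : Filter.Tendsto F Filter.atTop (nhds 1))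
    (hF_nondeg : (JSet F).Nonempty)
    (hF_cont : Continuous F)
    (hF_deriv : ∀ x ∈ JSet F, HasDerivAt F (f x) x)
    (h_anti : AntitoneOn (fun x => f x / F x ^ (1 - s / (1 + s))) (JSet F))
    (h_mono : MonotoneOn (fun x => f x / (1 - F x) ^ (1 - s / (1 + s))) (JSet F)) :
    (∀ x ∈ JSet F, 0 < f x) ∧
    BddAbove (f '' JSet F) ∧
    (∀ x ∈ JSet F, ∃ K : NNReal, ∃ U ∈ nhdsWithin x (JSet F), LipschitzOnWith K f U) ∧
    ∃ f' : ℝ → ℝ,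
      (∀ x ∈ JSet F, ∀ y ∈ JSet F, f y - f x = ∫ t in x..y, f' t) ∧
      (∀ᵐ x ∂(volume : Measure ℝ), x ∈ JSet F →
        -((1 - s / (1 + s)) * f x ^ 2 / (1 - F x)) ≤ f' x ∧
        f' x ≤ (1 - s / (1 + s)) * f x ^ 2 / F x) := by
  have hs' : s / (1 + s) ≤ 1 := (div_le_one (by linarith)).2 (by linarith)
  have hs₀ : 0 ≤ s / (1 + s) := by positivity
  generalize hp : 1 - s / (1 + s) = p at *
  have hp₀ : 0 ≤ p := by linarith
  have hp₁ : p ≤ 1 := by linarith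
  have hpos := pos_of_hazard_monotone hF_mono hF_bot hF_top hF_cont hF_deriv h_anti h_mono
  have hopen := isOpen_JSet hF_cont
  have hlip : ∀ a ∈ JSet F, ∀ b ∈ JSet F, ∃ K : NNReal, LipschitzOnWith K f (Icc a b) :=
    fun a ha b hb => exists_lipschitzOnWith_Icc_of_hazard_monotone hp₀ hp₁ hF_mono hF_deriv
      h_anti h_mono ha hb
  refine ⟨hpos, bddAbove_of_hazard_monotone hp₀ hF_mono hF_nondeg hF_deriv h_anti h_mono,
    fun x hx => ?_, deriv f, fun x hx y hy => ?_, ?_⟩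
  · obtain ⟨ε, hε, hball⟩ := Metric.nhds_basis_closedBall.mem_iff.1 (hopen.mem_nhds hx)
    rw [Real.closedBall_eq_Icc] at hball
    obtain ⟨K, hK⟩ := hlip _ (hball (left_mem_Icc.2 (by linarith))) _
      (hball (right_mem_Icc.2 (by linarith)))
    exact ⟨K, _, mem_nhdsWithin_of_mem_nhds (Icc_mem_nhds (by linarith) (by linarith)), hK⟩
  · obtain ⟨K, hK⟩ : ∃ K : NNReal, LipschitzOnWith K f (uIcc x y) := by
      rcases le_total x y with hxy | hyx
      · rw [uIcc_of_le hxy]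
        exact hlip x hx y hy
      · rw [uIcc_of_ge hyx]
        exact hlip y hy x hx
    exact hK.absolutelyContinuousOnInterval.integral_deriv_eq_sub.symm
  · have hbv : LocallyBoundedVariationOn f (JSet F) := fun a b ha hb => by
      obtain ⟨K, hK⟩ := hlip a ha b hb
      have hab := hK.locallyBoundedVariationOn
      rcases le_or_gt a b with hle | hlt
      · exact (hab a b (left_mem_Icc.2 hle) (right_mem_Icc.2 hle)).mono
          fun z hz => ⟨hz.2, hz.2⟩
      · simp [BoundedVariationOn, Icc_eq_empty_of_lt hlt]
    filter_upwards [hbv.ae_differentiableWithinAt_of_mem] with x hdiff hx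
    exact deriv_bounds_of_hazard_monotone hp₀ hp₁ hF_cont (fun y hy => (hpos y hy).le) hF_deriv
      h_anti h_mono hx ((hdiff hx).differentiableAt (hopen.mem_nhds hx)).hasDerivAt
end

section
/- Let s ∈ (0, ∞) and s* = s/(1+s) ∈ (0,1). Let F be a nondegenerate distribution function that is continuous on ℝ and differentiable on J(F) = (a,b) with derivative f = F′ such that f/F^{1−s*} is non-increasing and f/(1 − F)^{1−s*} is non-decreasing on J(F). Then F is bi-s*-concave: x ↦ F(x)^{s*} is concave on (a, ∞) and x ↦ (1 − F(x))^{s*} is concave on (−∞, b). -/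
open MeasureTheory Set Filter

/-- If `g / G ^ (1 - r)` is antitone on `(a, b)`, where `g = G'`, and the nondecreasing function `G`
is constant on `[b, ∞)`, then `G ^ r` is concave on `(a, ∞)`. -/
theorem concaveOn_Ioi_rpow_of_antitoneOn_div {G g : ℝ → ℝ} {a b r : ℝ} (hr : 0 < r) (hab : a < b)
    (hmono : Monotone G) (hcont : Continuous G) (hpos : ∀ x ∈ Ioo a b, 0 < G x)
    (hconst : ∀ x, b ≤ x → G x = G b) (hderiv : ∀ x ∈ Ioo a b, HasDerivAt G (g x) x)
    (hanti : AntitoneOn (fun x => g x / G x ^ (1 - r)) (Ioo a b)) :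
    ConcaveOn ℝ (Ioi a) (fun x => G x ^ r) := by
  have hd : ∀ x ∈ Ioo a b, HasDerivAt (fun x => G x ^ r) (r * (g x / G x ^ (1 - r))) x := by
    intro x hx
    convert (hderiv x hx).rpow_const (p := r) (Or.inl (hpos x hx).ne') using 1
    rw [show r - 1 = -(1 - r) by ring, Real.rpow_neg (hpos x hx).le]
    ring
  have hpos' : ∀ x ∈ Ioi a, 0 < G x := by
    intro x hx
    obtain ⟨y, hay, hy⟩ := exists_between (lt_min hx hab)
    exact (hpos y ⟨hay, hy.trans_le (min_le_right _ _)⟩).trans_le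
      (hmono (hy.le.trans (min_le_left _ _)))
  have hIoc : ConcaveOn ℝ (Ioc a b) (fun x => G x ^ r) := by
    apply AntitoneOn.concaveOn_of_deriv (convex_Ioc a b)
    · exact (hcont.rpow_const fun _ => Or.inr hr.le).continuousOn
    · rw [interior_Ioc]
      exact fun x hx => (hd x hx).differentiableAt.differentiableWithinAt
    · rw [interior_Ioc]
      intro x hx y hy hxy
      rw [(hd x hx).deriv, (hd y hy).deriv]
      exact mul_le_mul_of_nonneg_left (hanti hx hy hxy) hr.le
  have himage : (fun x => min x b) '' Ioi a = Ioc a b := by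
    ext y
    constructor
    · rintro ⟨x, hx, rfl⟩
      exact ⟨lt_min hx hab, min_le_right _ _⟩
    · exact fun hy => ⟨y, hy.1, min_eq_left hy.2⟩
  have hmin : ConcaveOn ℝ (Ioi a) (fun x => min x b) :=
    (concaveOn_id (convex_Ioi a)).inf (concaveOn_const b (convex_Ioi a))
  rw [← himage] at hIoc
  refine (hIoc.comp hmin ?_).congr ?_
  · rw [himage]
    exact fun x hx y _ hxy => Real.rpow_le_rpow (hpos' x hx.1).le (hmono hxy) hr.le
  · intro x _
    rcases le_total x b with h | h
    · simp [min_eq_left h]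
    · simp [min_eq_right h, hconst x h]

/-- Let `s ∈ (0,∞)`, `s* = s/(1+s) ∈ (0,1)`. If `F` is a nondegenerate
distribution function, continuous on `ℝ` and differentiable on `J(F) = (a,b)` with
derivative `f = F'` such that `f/F^{1-s*}` is non-increasing and `f/(1-F)^{1-s*}` is
non-decreasing on `J(F)`, then `F` is bi-`s*`-concave: `x ↦ F(x)^{s*}` is concave on
`(a,∞)` and `x ↦ (1-F(x))^{s*}` is concave on `(-∞,b)`. -/
theorem hazard_monotone_implies_bi_sStar_concave_pos
    (s : ℝ) (hs : 0 < s)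
    (F f : ℝ → ℝ) (a b : ℝ)
    (hF_mono : Monotone F)
    (hF_bot : Filter.Tendsto F Filter.atBot (nhds 0))
    (hF_top : Filter.Tendsto F Filter.atTop (nhds 1))
    (hF_nondeg : (JSet F).Nonempty)
    (hJ : JSet F = Set.Ioo a b)
    (hF_cont : Continuous F)
    (hF_deriv : ∀ x ∈ JSet F, HasDerivAt F (f x) x)
    (h_anti : AntitoneOn (fun x => f x / F x ^ (1 - s / (1 + s))) (JSet F))
    (h_mono : MonotoneOn (fun x => f x / (1 - F x) ^ (1 - s / (1 + s))) (JSet F)) :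
    ConcaveOn ℝ (Set.Ioi a) (fun x => F x ^ (s / (1 + s))) ∧
    ConcaveOn ℝ (Set.Iio b) (fun x => (1 - F x) ^ (s / (1 + s))) := by
  have hr : 0 < s / (1 + s) := by positivity
  obtain ⟨c, hc⟩ := hF_nondeg
  have hcab : c ∈ Ioo a b := hJ ▸ hc
  have hab : a < b := hcab.1.trans hcab.2
  have h_nonneg : ∀ x, 0 ≤ F x := hF_mono.le_of_tendsto hF_bot
  have h_le_one : ∀ x, F x ≤ 1 := hF_mono.ge_of_tendsto hF_top
  have h_eq_one : ∀ x, b ≤ x → F x = 1 := by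
    intro x hx
    by_contra hne
    have hmem : x ∈ JSet F :=
      ⟨hc.1.trans_le (hF_mono (hcab.2.le.trans hx)), lt_of_le_of_ne (h_le_one x) hne⟩
    rw [hJ] at hmem
    exact hmem.2.not_ge hx
  have h_eq_zero : ∀ x, x ≤ a → F x = 0 := by
    intro x hx
    by_contra hne
    have hmem : x ∈ JSet F :=
      ⟨lt_of_le_of_ne (h_nonneg x) (Ne.symm hne), (hF_mono (hx.trans hcab.1.le)).trans_lt hc.2⟩
    rw [hJ] at hmem
    exact hmem.1.not_ge hx
  have hJF : ∀ x ∈ Ioo a b, 0 < F x ∧ F x < 1 := fun x hx => hJ.symm.subset hx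
  rw [hJ] at hF_deriv h_anti h_mono
  refine ⟨concaveOn_Ioi_rpow_of_antitoneOn_div hr hab hF_mono hF_cont (fun x hx => (hJF x hx).1)
    (fun x hx => (h_eq_one x hx).trans (h_eq_one b le_rfl).symm) hF_deriv h_anti, ?_⟩
  have hneg : ∀ x ∈ Ioo (-b) (-a), -x ∈ Ioo a b := fun x hx =>
    ⟨lt_neg_of_lt_neg hx.2, neg_lt_of_neg_lt hx.1⟩
  have hreflect : ConcaveOn ℝ (Ioi (-b)) (fun x => (1 - F (-x)) ^ (s / (1 + s))) := by
    refine concaveOn_Ioi_rpow_of_antitoneOn_div (G := fun x => 1 - F (-x)) (g := fun x => f (-x))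
      hr (neg_lt_neg hab) (fun x y hxy => sub_le_sub_left (hF_mono (neg_le_neg hxy)) 1)
      (by fun_prop) (fun x hx => sub_pos.2 (hJF _ (hneg x hx)).2) ?_ ?_ ?_
    · intro x hx
      simp [h_eq_zero (-x) (neg_le_of_neg_le hx), h_eq_zero a le_rfl]
    · intro x hx
      simpa using ((hF_deriv _ (hneg x hx)).comp x (hasDerivAt_neg x)).const_sub 1
    · exact fun x hx y hy hxy => h_mono (hneg y hy) (hneg x hx) (neg_le_neg hxy)
  have hcomp := hreflect.comp_linearMap (-LinearMap.id)
  have hset : (-LinearMap.id : ℝ →ₗ[ℝ] ℝ) ⁻¹' Ioi (-b) = Iio b := by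
    ext x
    simp
  rw [hset] at hcomp
  exact hcomp.congr fun x _ => by simp
end

section
/- Let s ∈ (−1, 0), s* = s/(1+s) < 0, and let F be a nondegenerate bi-s*-concave distribution function (so x ↦ F(x)^{s*} and x ↦ (1 − F(x))^{s*} are convex on J(F)). Define F_U(x) = ((1 − F(x))^{s*} − 1)/(−s*) and F_L(x) = ((1 − s*) − F(x)^{s*})/(−s*) for x ∈ J(F). Then F_L(x) ≤ F(x) ≤ F_U(x) for all x ∈ J(F), F_U is convex on J(F), and F_L is concave on J(F). -/
open MeasureTheory Set Filter

/-- Bernoulli's inequality for nonpositive real exponents. -/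
theorem one_add_mul_sub_one_le_rpow_of_nonpos {t y : ℝ} (ht : t ≤ 0) (hy : 0 < y) :
    1 + t * (y - 1) ≤ y ^ t := by
  rw [Real.rpow_def_of_pos hy]
  have h₁ := Real.add_one_le_exp (Real.log y * t)
  have h₂ := mul_le_mul_of_nonpos_left (Real.log_le_sub_one_of_pos hy) ht
  linarith

/-- Let `s ∈ (-1,0)`, `s* = s/(1+s) < 0`, and let `F` be a nondegenerate
bi-`s*`-concave distribution function (`F^{s*}` and `(1-F)^{s*}` convex on `J(F)`).
With `F_U(x) = ((1-F(x))^{s*} - 1)/(-s*)` and `F_L(x) = ((1-s*) - F(x)^{s*})/(-s*)`,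
we have `F_L ≤ F ≤ F_U` on `J(F)`, `F_U` is convex on `J(F)` and `F_L` is concave
on `J(F)`. -/
theorem bounds_FU_FL_neg
    (s : ℝ) (hs : s ∈ Set.Ioo (-1 : ℝ) 0)
    (F : ℝ → ℝ)
    (hF_mono : Monotone F)
    (hF_bot : Filter.Tendsto F Filter.atBot (nhds 0))
    (hF_top : Filter.Tendsto F Filter.atTop (nhds 1))
    (hF_nondeg : (JSet F).Nonempty)
    (hconv1 : ConvexOn ℝ (JSet F) (fun x => F x ^ (s / (1 + s))))
    (hconv2 : ConvexOn ℝ (JSet F) (fun x => (1 - F x) ^ (s / (1 + s)))) :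
    (∀ x ∈ JSet F,
      ((1 - s / (1 + s)) - F x ^ (s / (1 + s))) / (-(s / (1 + s))) ≤ F x ∧
      F x ≤ ((1 - F x) ^ (s / (1 + s)) - 1) / (-(s / (1 + s)))) ∧
    ConvexOn ℝ (JSet F) (fun x => ((1 - F x) ^ (s / (1 + s)) - 1) / (-(s / (1 + s)))) ∧
    ConcaveOn ℝ (JSet F)
      (fun x => ((1 - s / (1 + s)) - F x ^ (s / (1 + s))) / (-(s / (1 + s)))) := by
  have ht : s / (1 + s) < 0 := div_neg_of_neg_of_pos hs.2 (by linarith [hs.1])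
  generalize s / (1 + s) = t at *
  have ht' : 0 < -t := neg_pos.mpr ht
  refine ⟨fun x hx => ⟨?_, ?_⟩, ?_, ?_⟩
  · rw [div_le_iff₀ ht']
    linarith [one_add_mul_sub_one_le_rpow_of_nonpos ht.le hx.1]
  · rw [le_div_iff₀ ht']
    linarith [one_add_mul_sub_one_le_rpow_of_nonpos ht.le (sub_pos.mpr hx.2)]
  · refine ((hconv2.add_const (-1)).smul (inv_nonneg.mpr ht'.le)).congr fun x _ => ?_
    simp only [Pi.add_apply, smul_eq_mul]
    ring
  · refine ((hconv1.neg.add_const (1 - t)).smul (inv_nonneg.mpr ht'.le)).congr fun x _ => ?_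
    simp only [Pi.add_apply, Pi.neg_apply, smul_eq_mul]
    ring
end

section
/- Let s ∈ (−1, ∞) and s* = s/(1+s). Let F be a nondegenerate bi-s*-concave distribution function with strictly positive, locally absolutely continuous density f on J(F) whose L¹-derivative f′ satisfies −(1 − s*) f²/(1 − F) ≤ f′ ≤ (1 − s*) f²/F almost everywhere on J(F). Then |f′(x)|/f(x) ≤ (1/(1+s)) · f(x)/min{F(x), 1 − F(x)} for almost every x ∈ J(F), and the Fisher information I_f := ∫_ℝ (f′(x)/f(x))² f(x) dx satisfies I_f ≤ (2/(1+s)²) · max{ ∫_ℝ (f(x)/F(x))² dF(x), ∫_ℝ (f(x)/(1 − F(x)))² dF(x) }. -/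
open MeasureTheory Set Filter

/-- `F` is bi-`s*`-concave (with `s* = s/(1+s)`): for `s ∈ (-1,0)`, `F^{s*}` and
`(1-F)^{s*}` are convex on `J(F)`; for `s = 0`, `log F` and `log (1-F)` are concave on
`J(F)`; for `s > 0`, `F^{s*}` is concave on `(inf J(F), ∞)` and `(1-F)^{s*}` is concave
on `(-∞, sup J(F))`. -/
def BiSStarConcave (s : ℝ) (F : ℝ → ℝ) : Prop :=
  (s < 0 →
    ConvexOn ℝ (JSet F) (fun x => F x ^ (s / (1 + s))) ∧
    ConvexOn ℝ (JSet F) (fun x => (1 - F x) ^ (s / (1 + s)))) ∧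
  (s = 0 →
    ConcaveOn ℝ (JSet F) (fun x => Real.log (F x)) ∧
    ConcaveOn ℝ (JSet F) (fun x => Real.log (1 - F x))) ∧
  (0 < s →
    ConcaveOn ℝ (Set.Ioi (sInf (JSet F))) (fun x => F x ^ (s / (1 + s))) ∧
    ConcaveOn ℝ (Set.Iio (sSup (JSet F))) (fun x => (1 - F x) ^ (s / (1 + s))))

/-- A nonnegative density vanishes almost everywhere on the flat pieces of its distribution
function. -/
theorem ae_eq_zero_of_flat {F f : ℝ → ℝ} (hmono : Monotone F) (hf : Integrable f)
    (hf_nonneg : ∀ x, 0 ≤ f x) (hF : ∀ x, F x = ∫ y in Set.Iic x, f y) :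
    ∀ᵐ y ∂(volume : Measure ℝ), (∃ a b, a < y ∧ y < b ∧ F a = F b) → f y = 0 := by
  have key : ∀ p q : ℚ, ∀ᵐ y ∂(volume : Measure ℝ),
      (p : ℝ) ≤ q → F p = F q → y ∈ Set.Ioc (p : ℝ) q → f y = 0 := by
    intro p q
    by_cases hpq : (p : ℝ) ≤ q
    · by_cases hFpq : F p = F q
      · have hint : ∫ y in Set.Ioc (p : ℝ) q, f y = 0 := by
          rw [← intervalIntegral.integral_of_le hpq,
            ← intervalIntegral.integral_Iic_sub_Iic hf.integrableOn hf.integrableOn,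
            ← hF, ← hF, hFpq, sub_self]
        rw [setIntegral_eq_zero_iff_of_nonneg_ae (ae_of_all _ hf_nonneg) hf.integrableOn] at hint
        have := (ae_restrict_iff' measurableSet_Ioc).1 hint
        filter_upwards [this] with y hy _ _ hmem using hy hmem
      · exact ae_of_all _ fun y _ h => absurd h hFpq
    · exact ae_of_all _ fun y h => absurd h hpq
  have key' := ae_all_iff.2 fun p => ae_all_iff.2 (key p)
  filter_upwards [key'] with y hy
  rintro ⟨a, b, hay, hyb, hab⟩
  obtain ⟨p, hap, hpy⟩ := exists_rat_btwn hay
  obtain ⟨q, hyq, hqb⟩ := exists_rat_btwn hyb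
  have hpq : (p : ℝ) ≤ q := (hpy.trans hyq).le
  refine hy p q hpq (le_antisymm (hmono hpq) ?_) ⟨hpy, hyq.le⟩
  calc F q ≤ F b := hmono hqb.le
    _ = F a := hab.symm
    _ ≤ F p := hmono hap.le

/-- A density of a distribution function with limits `0` and `1` is integrable. -/
theorem integrable_of_cdf {F f : ℝ → ℝ} (hF_mono : Monotone F)
    (hF_top : Filter.Tendsto F Filter.atTop (nhds 1)) (hf_nonneg : ∀ x, 0 ≤ f x)
    (hF : ∀ x, F x = ∫ y in Set.Iic x, f y) : Integrable f := by
  have hIic : ∀ x, IntegrableOn f (Set.Iic x) := by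
    intro x
    obtain ⟨y, hy, hxy⟩ :=
      ((hF_top.eventually (lt_mem_nhds zero_lt_one)).and (eventually_ge_atTop x)).exists
    have : IntegrableOn f (Set.Iic y) := by
      by_contra h
      rw [hF, integral_undef h] at hy
      exact lt_irrefl _ hy
    exact this.mono_set (Set.Iic_subset_Iic.2 hxy)
  refine integrable_of_intervalIntegral_norm_bounded (a := fun n : ℕ => -(n : ℝ))
    (b := fun n : ℕ => (n : ℝ)) (l := atTop) 1
    (fun n => (hIic n).mono_set Set.Ioc_subset_Iic_self)
    (tendsto_neg_atTop_atBot.comp tendsto_natCast_atTop_atTop) tendsto_natCast_atTop_atTop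
    (Eventually.of_forall fun n => ?_)
  have hn : -(n : ℝ) ≤ n := by linarith [Nat.cast_nonneg (α := ℝ) n]
  simp only [Real.norm_of_nonneg (hf_nonneg _)]
  rw [intervalIntegral.integral_of_le hn]
  calc ∫ y in Set.Ioc (-(n : ℝ)) n, f y ≤ ∫ y in Set.Iic (n : ℝ), f y :=
        setIntegral_mono_set (hIic n) (ae_of_all _ hf_nonneg)
          Set.Ioc_subset_Iic_self.eventuallyLE
    _ = F n := (hF n).symm
    _ ≤ 1 := hF_mono.ge_of_tendsto hF_top n

/-- The density vanishes almost everywhere outside `J(F)`. -/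
theorem ae_eq_zero_of_notMem_JSet {F f : ℝ → ℝ} (hF_mono : Monotone F)
    (hF_bot : Filter.Tendsto F Filter.atBot (nhds 0))
    (hF_top : Filter.Tendsto F Filter.atTop (nhds 1)) (hf : Integrable f)
    (hf_nonneg : ∀ x, 0 ≤ f x) (hF : ∀ x, F x = ∫ y in Set.Iic x, f y) :
    ∀ᵐ x ∂(volume : Measure ℝ), x ∉ JSet F → f x = 0 := by
  have h0 : ∀ x, 0 ≤ F x := hF_mono.le_of_tendsto hF_bot
  have h1 : ∀ x, F x ≤ 1 := hF_mono.ge_of_tendsto hF_top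
  filter_upwards [ae_eq_zero_of_flat hF_mono hf hf_nonneg hF,
    Measure.ae_ne volume (sSup {x | F x = 0}), Measure.ae_ne volume (sInf {x | F x = 1})]
    with x hx hsup hinf hxJ
  refine hx ?_
  rcases (h0 x).eq_or_lt with hx0 | hx0
  · obtain ⟨z, hz, hxz⟩ : ∃ z, F z = 0 ∧ x < z := by
      by_contra! h
      have hgr : IsGreatest {x | F x = 0} x := ⟨hx0.symm, fun z hz => h z hz⟩
      exact hsup hgr.csSup_eq.symm
    refine ⟨x - 1, z, by linarith, hxz, ?_⟩
    rw [hz]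
    exact le_antisymm (hx0 ▸ hF_mono (by linarith)) (h0 _)
  · have hx1 : F x = 1 := le_antisymm (h1 x) (not_lt.1 fun h => hxJ ⟨hx0, h⟩)
    obtain ⟨z, hz, hxz⟩ : ∃ z, F z = 1 ∧ z < x := by
      by_contra! h
      have hle : IsLeast {x | F x = 1} x := ⟨hx1, fun z hz => h z hz⟩
      exact hinf hle.csInf_eq.symm
    refine ⟨z, x + 1, hxz, by linarith, ?_⟩
    rw [hz]
    exact le_antisymm (hx1 ▸ hF_mono (by linarith)) (h1 _)

/-- Pointwise form of the two-sided derivative bound. -/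
theorem abs_div_le_of_two_sided_bound {c u p g : ℝ} (hc : 0 ≤ c) (hu : 0 < u) (hp : 0 < p)
    (hp1 : p < 1) (hl : -(c * u ^ 2 / (1 - p)) ≤ g) (hr : g ≤ c * u ^ 2 / p) :
    |g| / u ≤ c * (u / min p (1 - p)) := by
  have hq : 0 < 1 - p := by linarith
  have hm : 0 < min p (1 - p) := lt_min hp hq
  have hcu : 0 ≤ c * u ^ 2 := by positivity
  have hle : c * u ^ 2 / p ≤ c * u ^ 2 / min p (1 - p) :=
    div_le_div_of_nonneg_left hcu hm (min_le_left _ _)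
  have hle' : c * u ^ 2 / (1 - p) ≤ c * u ^ 2 / min p (1 - p) :=
    div_le_div_of_nonneg_left hcu hm (min_le_right _ _)
  rw [div_le_iff₀ hu, abs_le]
  have heq : c * (u / min p (1 - p)) * u = c * u ^ 2 / min p (1 - p) := by ring
  rw [heq]
  constructor <;> linarith

/-- Squaring the pointwise bound and splitting the minimum. -/
theorem sq_mul_le_of_abs_div_le {c u p g : ℝ} (hu : 0 < u)
    (h : |g| / u ≤ c * (u / min p (1 - p))) :
    (g / u) ^ 2 * u ≤ c ^ 2 * ((u / p) ^ 2 * u + (u / (1 - p)) ^ 2 * u) := by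
  have hsq : (g / u) ^ 2 ≤ (c * (u / min p (1 - p))) ^ 2 := by
    rw [← sq_abs (g / u), abs_div, abs_of_pos hu]
    exact pow_le_pow_left₀ (by positivity) h 2
  have hmin : (u / min p (1 - p)) ^ 2 ≤ (u / p) ^ 2 + (u / (1 - p)) ^ 2 := by
    rcases min_choice p (1 - p) with h | h <;> rw [h]
    · exact le_add_of_nonneg_right (sq_nonneg _)
    · exact le_add_of_nonneg_left (sq_nonneg _)
  calc (g / u) ^ 2 * u ≤ (c * (u / min p (1 - p))) ^ 2 * u := by gcongr
    _ = c ^ 2 * (u / min p (1 - p)) ^ 2 * u := by ring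
    _ ≤ c ^ 2 * ((u / p) ^ 2 + (u / (1 - p)) ^ 2) * u := by gcongr
    _ = _ := by ring

/-- Let `s ∈ (-1,∞)`, `s* = s/(1+s)`. If `F` is a nondegenerate
bi-`s*`-concave distribution function with strictly positive, locally absolutely
continuous density `f` on `J(F)` whose `L¹`-derivative `f'` satisfies
`-(1-s*) f²/(1-F) ≤ f' ≤ (1-s*) f²/F` a.e. on `J(F)`, then
`|f'(x)|/f(x) ≤ (1/(1+s)) · f(x)/min{F(x), 1-F(x)}` for a.e. `x ∈ J(F)` and the Fisher
information `I_f = ∫ (f'/f)² f dx` satisfies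
`I_f ≤ (2/(1+s)²) · max{∫ (f/F)² dF, ∫ (f/(1-F))² dF}` (Lebesgue integrals in `ℝ≥0∞`). -/
theorem fisher_information_bound_of_bi_sStar_concave
    (s : ℝ) (hs : -1 < s)
    (F f f' : ℝ → ℝ)
    (hF_mono : Monotone F)
    (hF_bot : Filter.Tendsto F Filter.atBot (nhds 0))
    (hF_top : Filter.Tendsto F Filter.atTop (nhds 1))
    (hF_nondeg : (JSet F).Nonempty)
    (hbi : BiSStarConcave s F)
    (hf_nonneg : ∀ x, 0 ≤ f x)
    (hF_density : ∀ x, F x = ∫ y in Set.Iic x, f y)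
    (hf_pos : ∀ x ∈ JSet F, 0 < f x)
    (hf_ftc : ∀ x ∈ JSet F, ∀ y ∈ JSet F, f y - f x = ∫ t in x..y, f' t)
    (hf'_bounds : ∀ᵐ x ∂(volume : Measure ℝ), x ∈ JSet F →
      -((1 - s / (1 + s)) * f x ^ 2 / (1 - F x)) ≤ f' x ∧
      f' x ≤ (1 - s / (1 + s)) * f x ^ 2 / F x) :
    (∀ᵐ x ∂(volume : Measure ℝ), x ∈ JSet F →
      |f' x| / f x ≤ (1 / (1 + s)) * (f x / min (F x) (1 - F x))) ∧
    (∫⁻ x, ENNReal.ofReal ((f' x / f x) ^ 2 * f x) ≤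
      ENNReal.ofReal (2 / (1 + s) ^ 2) *
        max (∫⁻ x, ENNReal.ofReal ((f x / F x) ^ 2 * f x))
          (∫⁻ x, ENNReal.ofReal ((f x / (1 - F x)) ^ 2 * f x))) := by
  have hc : 1 - s / (1 + s) = 1 / (1 + s) := by
    have : 1 + s ≠ 0 := by linarith
    field_simp
    ring
  have hc0 : 0 ≤ 1 / (1 + s) := one_div_nonneg.2 (by linarith)
  have hbound : ∀ᵐ x ∂(volume : Measure ℝ), x ∈ JSet F →
      |f' x| / f x ≤ (1 / (1 + s)) * (f x / min (F x) (1 - F x)) := by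
    filter_upwards [hf'_bounds] with x hx hxJ
    obtain ⟨hl, hr⟩ := hx hxJ
    rw [hc] at hl hr
    exact abs_div_le_of_two_sided_bound hc0 (hf_pos x hxJ) hxJ.1 hxJ.2 hl hr
  refine ⟨hbound, ?_⟩
  have hf : Integrable f := integrable_of_cdf hF_mono hF_top hf_nonneg hF_density
  have hmeas : AEMeasurable (fun x => ENNReal.ofReal ((f x / F x) ^ 2 * f x)) :=
    (((hf.aemeasurable.div hF_mono.measurable.aemeasurable).pow_const 2).mul
      hf.aemeasurable).ennreal_ofReal
  set A := ∫⁻ x, ENNReal.ofReal ((f x / F x) ^ 2 * f x) with hA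
  set B := ∫⁻ x, ENNReal.ofReal ((f x / (1 - F x)) ^ 2 * f x) with hB
  have hpt : ∀ᵐ x ∂(volume : Measure ℝ), ENNReal.ofReal ((f' x / f x) ^ 2 * f x) ≤
      ENNReal.ofReal ((1 / (1 + s)) ^ 2) * (ENNReal.ofReal ((f x / F x) ^ 2 * f x) +
        ENNReal.ofReal ((f x / (1 - F x)) ^ 2 * f x)) := by
    filter_upwards [hbound,
      ae_eq_zero_of_notMem_JSet hF_mono hF_bot hF_top hf hf_nonneg hF_density] with x hx hx0
    by_cases hxJ : x ∈ JSet F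
    · have hfx := hf_pos x hxJ
      rw [← ENNReal.ofReal_add (by positivity) (by positivity),
        ← ENNReal.ofReal_mul (by positivity)]
      exact ENNReal.ofReal_le_ofReal (sq_mul_le_of_abs_div_le hfx (hx hxJ))
    · simp [hx0 hxJ]
  calc ∫⁻ x, ENNReal.ofReal ((f' x / f x) ^ 2 * f x)
      ≤ ENNReal.ofReal ((1 / (1 + s)) ^ 2) * (A + B) := by
        rw [hA, hB, ← lintegral_add_left' hmeas, ← lintegral_const_mul' _ _ ENNReal.ofReal_ne_top]
        exact lintegral_mono_ae hpt
    _ ≤ ENNReal.ofReal ((1 / (1 + s)) ^ 2) * (2 * max A B) := by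
        rw [two_mul]
        gcongr
        · exact le_max_left _ _
        · exact le_max_right _ _
    _ = ENNReal.ofReal (2 / (1 + s) ^ 2) * max A B := by
        rw [← mul_assoc, show (2 : ENNReal) = ENNReal.ofReal 2 by simp,
          ← ENNReal.ofReal_mul (by positivity)]
        congr 2
        rw [div_pow, one_pow]
        ring
end
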